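/- arXiv:1304.6308 — 3 statements merged into one kernel-verified Lean document; each statement's English description precedes it below -/
import Mathlib

section
/- Blaschke–Santaló inequality (origin-symmetric case): for every origin-symmetric convex body K in ℝ^{n+1}, the Mahler volume satisfies V(K)·V(K°) ≤ V(B)² = ω_{n+1}², where B is the closed unit ball of ℝ^{n+1}. -/
open MeasureTheory Metric
open scoped RealInnerProductSpace

/-- The polar body `K° = {y : ⟨x,y⟩ ≤ 1 for all x ∈ K}`. -/
noncomputable def polarBody {n : ℕ} (K : Set (EuclideanSpace ℝ (Fin (n + 1)))) :
    Set (EuclideanSpace ℝ (Fin (n + 1))) :=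
  {y | ∀ x ∈ K, ⟪x, y⟫ ≤ 1}


lemma bm1_compact {X Y Z : Set ℝ} (hX : IsCompact X) (hY : IsCompact Y) (hX0 : X.Nonempty)
    (hY0 : Y.Nonempty) (h : ∀ x ∈ X, ∀ y ∈ Y, x + y ∈ Z) :
    volume X + volume Y ≤ volume Z := by
  obtain ⟨a, ha, ha'⟩ := hX.exists_isGreatest hX0
  obtain ⟨b, hb, hb'⟩ := hY.exists_isLeast hY0
  have e1 : volume X = volume ((fun x => x + b) '' X) := by
    rw [Set.image_add_right]; simp
  have e2 : volume Y = volume ((fun x => a + x) '' Y) := by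
    rw [Set.image_add_left]; simp
  have m2 : MeasurableSet ((fun x => a + x) '' Y) :=
    (hY.image (by fun_prop)).measurableSet
  have hd : AEDisjoint volume ((fun x => x + b) '' X) ((fun x => a + x) '' Y) := by
    refine measure_mono_null (t := {a + b}) ?_ (by simp)
    rintro z ⟨⟨x, hx, rfl⟩, ⟨y, hy, hxy⟩⟩
    have h1 := ha' hx
    have h2 := hb' hy
    simp only at hxy
    simp only [Set.mem_singleton_iff]
    linarith
  rw [e1, e2, ← measure_union₀ m2.nullMeasurableSet hd]
  apply measure_mono
  rintro z (⟨x, hx, rfl⟩ | ⟨y, hy, rfl⟩)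
  · exact h x hx b hb
  · exact h a ha y hy

lemma bm1 {X Y Z : Set ℝ} (hX : MeasurableSet X) (hY : MeasurableSet Y) (hX0 : X.Nonempty)
    (hY0 : Y.Nonempty) (h : ∀ x ∈ X, ∀ y ∈ Y, x + y ∈ Z) :
    volume X + volume Y ≤ volume Z := by
  obtain ⟨a, ha⟩ := hX0
  obtain ⟨b, hb⟩ := hY0
  rw [hX.measure_eq_iSup_isCompact, hY.measure_eq_iSup_isCompact]
  simp_rw [iSup_and']
  refine ENNReal.biSup_add_biSup_le' ⟨∅, by simp⟩ ⟨∅, by simp⟩ ?_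
  rintro K ⟨hK, hKc⟩ L ⟨hL, hLc⟩
  refine (add_le_add (measure_mono (Set.subset_insert a K))
    (measure_mono (Set.subset_insert b L))).trans ?_
  refine bm1_compact (hKc.insert a) (hLc.insert b) ⟨a, by simp⟩ ⟨b, by simp⟩ ?_
  intro x hx y hy
  refine h x ?_ y ?_
  · rcases hx with rfl | hx
    exacts [ha, hK hx]
  · rcases hy with rfl | hy
    exacts [hb, hL hy]

lemma four_mul_le_ennreal (a b : ENNReal) : 4 * (a * b) ≤ (a + b) ^ 2 := by
  by_cases ha : a = ⊤
  · simp [ha]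
  by_cases hb : b = ⊤
  · simp [hb]
  lift a to NNReal using ha
  lift b to NNReal using hb
  norm_cast
  have := sq_nonneg ((a:ℝ) - b)
  rw [← NNReal.coe_le_coe]; push_cast; nlinarith

lemma pl_norm {A B H : ℝ → ℝ} (mA : Measurable A) (mB : Measurable B) (mH : Measurable H)
    (A0 : ∀ u, 0 ≤ A u) (B0 : ∀ u, 0 ≤ B u) (H0 : ∀ u, 0 ≤ H u)
    (A1 : ∀ u, A u ≤ 1) (B1 : ∀ u, B u ≤ 1)
    (A2 : ∀ t < 1, ∃ u, t < A u) (B2 : ∀ t < 1, ∃ u, t < B u)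
    (h : ∀ u v, A u * B v ≤ H ((u + v) / 2) ^ 2) :
    (∫⁻ u, ENNReal.ofReal (A u)) * (∫⁻ u, ENNReal.ofReal (B u)) ≤
      (∫⁻ u, ENNReal.ofReal (H u)) ^ 2 := by
  have key : (∫⁻ u, ENNReal.ofReal (A u)) + (∫⁻ u, ENNReal.ofReal (B u)) ≤
      2 * (∫⁻ u, ENNReal.ofReal (H u)) := by
    rw [lintegral_eq_lintegral_meas_lt volume (.of_forall A0) mA.aemeasurable,
      lintegral_eq_lintegral_meas_lt volume (.of_forall B0) mB.aemeasurable,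
      lintegral_eq_lintegral_meas_lt volume (.of_forall H0) mH.aemeasurable,
      ← lintegral_const_mul' _ _ (by simp), ← lintegral_add_left]
    · refine setLIntegral_mono' measurableSet_Ioi ?_
      intro t ht
      simp only [Set.mem_Ioi] at ht
      by_cases ht1 : t < 1
      · have := bm1 (X := {u | t < A u}) (Y := {u | t < B u}) (Z := {z | t < H (z / 2)})
          (measurableSet_lt measurable_const mA) (measurableSet_lt measurable_const mB)
          (A2 t ht1) (B2 t ht1) ?_
        · refine this.trans (le_of_eq ?_)
          have : {z | t < H (z / 2)} = (fun z => (1/2 : ℝ) * z) ⁻¹' {u | t < H u} := by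
            ext z; simp; ring_nf
          rw [this, Real.volume_preimage_mul_left (by norm_num)]
          simp
        · intro x hx y hy
          simp only [Set.mem_ofPred_eq] at hx hy ⊢
          have := h x y
          by_contra hc
          push Not at hc
          have h1 := H0 ((x + y) / 2)
          nlinarith [mul_lt_mul'' hx hy ht.le ht.le]
      · have e1 : {u | t < A u} = ∅ := by
          ext u; simp; linarith [A1 u]
        have e2 : {u | t < B u} = ∅ := by
          ext u; simp; linarith [B1 u]
        rw [e1, e2]; simp
    · refine Antitone.measurable ?_
      intro s t hst
      exact measure_mono fun x (hx : t < A x) => lt_of_le_of_lt hst hx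
  have h4 := four_mul_le_ennreal (∫⁻ u, ENNReal.ofReal (A u)) (∫⁻ u, ENNReal.ofReal (B u))
  have h5 := h4.trans (pow_le_pow_left' key 2)
  rw [mul_pow] at h5
  norm_num at h5
  exact (ENNReal.mul_le_mul_iff_right (by norm_num) (by norm_num)).1 h5

lemma pl_bdd {A B H : ℝ → ℝ} (mA : Measurable A) (mB : Measurable B) (mH : Measurable H)
    (A0 : ∀ u, 0 ≤ A u) (B0 : ∀ u, 0 ≤ B u) (H0 : ∀ u, 0 ≤ H u) {c : ℝ}
    (A1 : ∀ u, A u ≤ c) (B1 : ∀ u, B u ≤ c)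
    (h : ∀ u v, A u * B v ≤ H ((u + v) / 2) ^ 2) :
    (∫⁻ u, ENNReal.ofReal (A u)) * (∫⁻ u, ENNReal.ofReal (B u)) ≤
      (∫⁻ u, ENNReal.ofReal (H u)) ^ 2 := by
  by_cases hA : ∀ u, A u = 0
  · simp [hA]
  by_cases hB : ∀ u, B u = 0
  · simp [hB]
  push Not at hA hB
  have bA : BddAbove (Set.range A) := ⟨c, by rintro _ ⟨u, rfl⟩; exact A1 u⟩
  have bB : BddAbove (Set.range B) := ⟨c, by rintro _ ⟨u, rfl⟩; exact B1 u⟩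
  set M := ⨆ u, A u with hM
  set N := ⨆ u, B u with hN
  have M0 : 0 < M := by
    obtain ⟨u, hu⟩ := hA
    exact lt_of_lt_of_le (lt_of_le_of_ne (A0 u) hu.symm) (le_ciSup bA u)
  have N0 : 0 < N := by
    obtain ⟨u, hu⟩ := hB
    exact lt_of_lt_of_le (lt_of_le_of_ne (B0 u) hu.symm) (le_ciSup bB u)
  have S0 : 0 < √(M * N) := Real.sqrt_pos.2 (by positivity)
  have := pl_norm (A := fun u => M⁻¹ * A u) (B := fun u => N⁻¹ * B u)
    (H := fun u => (√(M * N))⁻¹ * H u)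
    (by fun_prop) (by fun_prop) (by fun_prop) (fun u => mul_nonneg (by positivity) (A0 u))
    (fun u => mul_nonneg (by positivity) (B0 u)) (fun u => mul_nonneg (by positivity) (H0 u))
    (fun u => by
      rw [inv_mul_le_iff₀ M0, mul_one]; exact le_ciSup bA u)
    (fun u => by
      rw [inv_mul_le_iff₀ N0, mul_one]; exact le_ciSup bB u)
    (fun t ht => by
      obtain ⟨u, hu⟩ := exists_lt_of_lt_ciSup (show t * M < ⨆ u, A u by rw [← hM]; nlinarith)
      exact ⟨u, by rw [lt_inv_mul_iff₀ M0]; linarith⟩)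
    (fun t ht => by
      obtain ⟨u, hu⟩ := exists_lt_of_lt_ciSup (show t * N < ⨆ u, B u by rw [← hN]; nlinarith)
      exact ⟨u, by rw [lt_inv_mul_iff₀ N0]; linarith⟩)
    (fun u v => by
      rw [mul_pow, inv_pow, Real.sq_sqrt (by positivity), mul_inv]
      have := mul_le_mul_of_nonneg_left (h u v) (show 0 ≤ M⁻¹ * N⁻¹ by positivity)
      linarith)
  simp_rw [ENNReal.ofReal_mul (inv_nonneg.2 M0.le), ENNReal.ofReal_mul (inv_nonneg.2 N0.le),
    ENNReal.ofReal_mul (inv_nonneg.2 S0.le)] at this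
  rw [lintegral_const_mul' _ _ (by simp), lintegral_const_mul' _ _ (by simp),
    lintegral_const_mul' _ _ (by simp), mul_pow, mul_mul_mul_comm, ← ENNReal.ofReal_pow (by positivity),
    ← ENNReal.ofReal_mul (by positivity), inv_pow, Real.sq_sqrt (by positivity), mul_inv] at this
  exact (ENNReal.mul_le_mul_iff_right (by simp; positivity) (by simp)).1 this

lemma iSup_min_nat (a : ENNReal) : ⨆ k : ℕ, min a k = a := by
  rw [← inf_iSup_eq, ENNReal.iSup_natCast, inf_top_eq]

lemma lintegral_iSup_min {α : Type*} [MeasurableSpace α] (μ : Measure α) {A : α → ENNReal}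
    (mA : Measurable A) :
    ∫⁻ u, A u ∂μ = ⨆ k : ℕ, ∫⁻ u, min (A u) k ∂μ := by
  rw [← lintegral_iSup]
  · simp_rw [iSup_min_nat]
  · intro k; fun_prop
  · intro k l hkl u
    exact min_le_min le_rfl (by exact_mod_cast hkl)

lemma pl {A B : ℝ → ENNReal} {H : ℝ → ℝ} (mA : Measurable A) (mB : Measurable B)
    (mH : Measurable H) (H0 : ∀ u, 0 ≤ H u)
    (h : ∀ u v, A u * B v ≤ ENNReal.ofReal (H ((u + v) / 2) ^ 2)) :
    (∫⁻ u, A u) * (∫⁻ u, B u) ≤ (∫⁻ u, ENNReal.ofReal (H u)) ^ 2 := by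
  have key : ∀ k : ℕ, (∫⁻ u, min (A u) k) * (∫⁻ u, min (B u) k) ≤
      (∫⁻ u, ENNReal.ofReal (H u)) ^ 2 := by
    intro k
    have t1 : ∀ a : ENNReal, min a k ≠ ⊤ := fun a =>
      ne_top_of_le_ne_top (ENNReal.natCast_ne_top k) (min_le_right _ _)
    have t2 : ∀ a : ENNReal, (min a k).toReal ≤ k := fun a =>
      ENNReal.toReal_le_of_le_ofReal (by positivity) (by simp)
    have := pl_bdd (A := fun u => (min (A u) k).toReal) (B := fun u => (min (B u) k).toReal)
      (H := H) (by fun_prop) (by fun_prop) mH (fun _ => ENNReal.toReal_nonneg)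
      (fun _ => ENNReal.toReal_nonneg) H0 (c := k) (fun u => t2 _) (fun u => t2 _) (fun u v => by
        rw [← ENNReal.toReal_mul]
        refine ENNReal.toReal_le_of_le_ofReal (by positivity) (le_trans ?_ (h u v))
        exact mul_le_mul' (min_le_left _ _) (min_le_left _ _))
    simpa only [ENNReal.ofReal_toReal (t1 _)] using this
  rw [lintegral_iSup_min volume mA, lintegral_iSup_min volume mB, ENNReal.iSup_mul]
  refine iSup_le fun i => ?_
  rw [ENNReal.mul_iSup]
  refine iSup_le fun j => ?_
  refine le_trans (mul_le_mul' ?_ ?_) (key (max i j))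
  · exact lintegral_mono fun u => min_le_min le_rfl (by exact_mod_cast le_max_left _ _)
  · exact lintegral_mono fun u => min_le_min le_rfl (by exact_mod_cast le_max_right _ _)

lemma lint_exp (φ : ℝ → ENNReal) :
    ∫⁻ s in Set.Ioi 0, φ s = ∫⁻ u, ENNReal.ofReal (Real.exp u) * φ (Real.exp u) := by
  have := lintegral_image_eq_lintegral_abs_deriv_mul (s := Set.univ) (f := Real.exp)
    (f' := Real.exp) MeasurableSet.univ (fun x _ => (Real.hasDerivAt_exp x).hasDerivWithinAt)
    Real.exp_injective.injOn φ
  simpa [Real.range_exp, abs_of_pos (Real.exp_pos _)] using this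

lemma mult1 {φ ψ : ℝ → ENNReal} (mφ : Measurable φ) (mψ : Measurable ψ) {C : ℝ} (hC : 0 ≤ C)
    (h : ∀ s > 0, ∀ t > 0, φ s * ψ t ≤ ENNReal.ofReal (C * Real.exp (-2 * (s * t)))) :
    (∫⁻ s in Set.Ioi 0, φ s) * (∫⁻ s in Set.Ioi 0, ψ s) ≤ ENNReal.ofReal (C * (Real.pi / 4)) := by
  have := pl (A := fun u => ENNReal.ofReal (Real.exp u) * φ (Real.exp u))
    (B := fun u => ENNReal.ofReal (Real.exp u) * ψ (Real.exp u))
    (H := fun u => Real.exp u * (√C * Real.exp (- (Real.exp u) ^ 2))) (by fun_prop) (by fun_prop)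
    (by fun_prop) (fun u => by positivity) (fun u v => by
      rw [mul_mul_mul_comm, ← ENNReal.ofReal_mul (by positivity)]
      refine (mul_le_mul_right (h _ (Real.exp_pos u) _ (Real.exp_pos v)) _).trans ?_
      rw [← ENNReal.ofReal_mul (by positivity)]
      refine ENNReal.ofReal_le_ofReal (le_of_eq ?_)
      simp only [mul_pow, Real.sq_sqrt hC, ← Real.exp_nat_mul, ← Real.exp_add]
      push_cast
      rw [show 2 * ((u + v) / 2) = u + v by ring]
      ring_nf)
  rw [lint_exp, lint_exp]
  refine this.trans (le_of_eq ?_)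
  simp_rw [ENNReal.ofReal_mul (Real.exp_pos _).le]
  rw [← lint_exp (fun x => ENNReal.ofReal (√C * Real.exp (- x ^ 2)))]
  rw [← ofReal_integral_eq_lintegral_ofReal, ← ENNReal.ofReal_pow]
  · congr 1
    have := integral_gaussian_Ioi 1
    simp only [neg_mul, one_mul, div_one] at this
    rw [integral_const_mul, this, mul_pow, Real.sq_sqrt hC, div_pow, Real.sq_sqrt Real.pi_pos.le]
    norm_num
  · exact integral_nonneg fun x => by positivity
  · have := (integrable_exp_neg_mul_sq (b := 1) one_pos).integrableOn (s := Set.Ioi 0)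
    simp only [neg_mul, one_mul] at this
    exact this.const_mul _
  · exact .of_forall fun x => by positivity

structure Nice {E : Type*} [NormedAddCommGroup E] [MeasureSpace E] (f : E → ℝ) : Prop where
  meas : Measurable f
  nonneg : ∀ x, 0 ≤ f x
  int : Integrable f
  supp : ∃ R : ℝ, ∀ x, R < ‖x‖ → f x = 0

lemma Nice.integrable_mul {E : Type*} [NormedAddCommGroup E] [MeasureSpace E] [BorelSpace E]
    [ProperSpace E] [SecondCountableTopology E]
    {f : E → ℝ} (hf : Nice f) {l : E → ℝ} (hl : Continuous l) :
    Integrable (fun x => f x * l x) := by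
  obtain ⟨R, hR⟩ := hf.supp
  obtain ⟨M, hM⟩ := (isCompact_closedBall (0 : E) R).exists_bound_of_continuousOn hl.continuousOn
  refine (hf.int.mul_const M).mono' (hf.meas.mul hl.measurable).aestronglyMeasurable ?_
  refine .of_forall fun x => ?_
  by_cases hx : R < ‖x‖
  · simp [hR x hx]
  · rw [norm_mul, Real.norm_of_nonneg (hf.nonneg x)]
    exact mul_le_mul_of_nonneg_left (hM x (by simpa using hx)) (hf.nonneg x)

lemma Nice.comp_add {E : Type*} [NormedAddCommGroup E] [MeasureSpace E] [BorelSpace E]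
    [(volume : Measure E).IsAddLeftInvariant] [SecondCountableTopology E]
    {f : E → ℝ} (hf : Nice f) (z : E) : Nice (fun x => f (z + x)) where
  meas := hf.meas.comp (measurable_const_add z)
  nonneg x := hf.nonneg _
  int := hf.int.comp_add_left z
  supp := by
    obtain ⟨R, hR⟩ := hf.supp
    refine ⟨R + ‖z‖, fun x hx => hR _ ?_⟩
    have := norm_sub_le (z + x) z
    rw [add_sub_cancel_left] at this
    linarith

lemma Nice.comp_neg {E : Type*} [NormedAddCommGroup E] [MeasureSpace E] [BorelSpace E]
    [(volume : Measure E).IsNegInvariant] [SecondCountableTopology E]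
    {f : E → ℝ} (hf : Nice f) : Nice (fun x => f (-x)) where
  meas := hf.meas.comp measurable_neg
  nonneg x := hf.nonneg _
  int := hf.int.comp_neg
  supp := by
    obtain ⟨R, hR⟩ := hf.supp
    exact ⟨R, fun x hx => hR _ (by simpa using hx)⟩

lemma ofReal_integral_le {α : Type*} [MeasurableSpace α] (μ : Measure α) {f : α → ℝ}
    (h0 : ∀ x, 0 ≤ f x) :
    ENNReal.ofReal (∫ x, f x ∂μ) ≤ ∫⁻ x, ENNReal.ofReal (f x) ∂μ := by
  by_cases h : Integrable f μ
  · exact (ofReal_integral_eq_lintegral_ofReal h (.of_forall h0)).le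
  · simp [integral_undef h]

def PP (n : ℕ) : Prop :=
  ∀ f : (Fin n → ℝ) → ℝ, Nice f → (∀ i, ∫ x, f x * x i = 0) → ∀ g : (Fin n → ℝ) → ENNReal,
    Measurable g → ∀ C : ℝ, 0 ≤ C →
    (∀ x y, ENNReal.ofReal (f x) * g y ≤ ENNReal.ofReal (C * Real.exp (-2 * (x ⬝ᵥ y)))) →
    (∫⁻ x, ENNReal.ofReal (f x)) * (∫⁻ y, g y) ≤ ENNReal.ofReal (C * Real.pi ^ n)

lemma PP_zero : PP 0 := by
  intro f hf _ g hg C hC h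
  simp only [Measure.volume_pi_eq_dirac (0 : Fin 0 → ℝ)]
  rw [lintegral_dirac, lintegral_dirac]
  simpa using h 0 0

section step
variable {n : ℕ}

lemma shear_mp (w : Fin n → ℝ) : MeasurePreserving
    (fun x : ℝ × (Fin n → ℝ) => (x.1, x.2 + x.1 • w)) := by
  refine MeasurePreserving.skew_product (μa := volume) (μc := volume) (g := fun s y => y + s • w)
    (MeasurePreserving.id _) (by fun_prop) ?_
  exact .of_forall fun s => (measurePreserving_add_right volume (s • w)).map_eq

lemma shear_mp' (w : Fin n → ℝ) : MeasurePreserving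
    (fun x : ℝ × (Fin n → ℝ) => (x.1 - w ⬝ᵥ x.2, x.2)) := by
  have h : MeasurePreserving (fun x : (Fin n → ℝ) × ℝ => (x.1, x.2 - w ⬝ᵥ x.1))
      (volume.prod volume) (volume.prod volume) := by
    refine MeasurePreserving.skew_product (μa := volume) (μc := volume)
      (g := fun y s => s - w ⬝ᵥ y) (MeasurePreserving.id _) (by unfold dotProduct; fun_prop) ?_
    exact .of_forall fun y => (measurePreserving_sub_right volume (w ⬝ᵥ y)).map_eq
  exact (Measure.measurePreserving_swap.comp h).comp Measure.measurePreserving_swap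

lemma half (hP : PP n) {f : ℝ × (Fin n → ℝ) → ℝ} (hf : Nice f) (w : Fin n → ℝ)
    (hw : ∀ i, ∫ x in {x : ℝ × (Fin n → ℝ) | 0 < x.1}, f x * (x.2 i - x.1 * w i) = 0)
    {g : ℝ × (Fin n → ℝ) → ENNReal} (hg : Measurable g) {C : ℝ} (hC : 0 ≤ C)
    (h : ∀ x y, ENNReal.ofReal (f x) * g y ≤
      ENNReal.ofReal (C * Real.exp (-2 * (x.1 * y.1 + x.2 ⬝ᵥ y.2)))) :
    (∫⁻ x in {x : ℝ × (Fin n → ℝ) | 0 < x.1}, ENNReal.ofReal (f x)) *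
      (∫⁻ y in {y : ℝ × (Fin n → ℝ) | 0 ≤ y.1 + w ⬝ᵥ y.2}, g y) ≤
      ENNReal.ofReal (C * (Real.pi ^ (n + 1) / 4)) := by
  have ms : MeasurableSet {x : ℝ × (Fin n → ℝ) | 0 < x.1} :=
    measurableSet_lt measurable_const measurable_fst
  have mdot : Measurable fun y : ℝ × (Fin n → ℝ) => y.1 + w ⬝ᵥ y.2 := by
    unfold dotProduct; fun_prop
  have ms' : MeasurableSet {y : ℝ × (Fin n → ℝ) | 0 ≤ y.1 + w ⬝ᵥ y.2} :=
    measurableSet_le measurable_const mdot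
  set T := fun x : ℝ × (Fin n → ℝ) => (x.1, x.2 + x.1 • w) with hT
  set T' := fun x : ℝ × (Fin n → ℝ) => (x.1 - w ⬝ᵥ x.2, x.2) with hT'
  have mT : MeasurePreserving T := shear_mp w
  have mT' : MeasurePreserving T' := shear_mp' w
  set f2 := Set.indicator {x : ℝ × (Fin n → ℝ) | 0 < x.1} f with hf2
  set g2 := Set.indicator {y : ℝ × (Fin n → ℝ) | 0 ≤ y.1 + w ⬝ᵥ y.2} g with hg2
  have mf2 : Measurable f2 := hf.meas.indicator ms
  have mg2 : Measurable g2 := hg.indicator ms'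
  have f20 : ∀ x, 0 ≤ f2 x := fun x => Set.indicator_nonneg (fun x _ => hf.nonneg x) x
  have if2 : Integrable f2 := hf.int.indicator ms
  have if2T : Integrable (f2 ∘ T) := mT.integrable_comp_of_integrable if2
  set F := fun y : Fin n → ℝ => ∫ s, f2 (T (s, y)) with hF
  set G := fun y : Fin n → ℝ => ∫⁻ t, g2 (T' (t, y)) with hG
  have iF : Integrable F := if2T.integral_prod_right
  have F0 : ∀ y, 0 ≤ F y := fun y => integral_nonneg fun s => f20 _
  have hFint : ∫⁻ y, ENNReal.ofReal (F y) = ∫⁻ x, ENNReal.ofReal (f2 x) := by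
    rw [← ofReal_integral_eq_lintegral_ofReal iF (.of_forall F0),
      ← ofReal_integral_eq_lintegral_ofReal if2 (.of_forall f20)]
    congr 1
    rw [← mT.map_eq, integral_map mT.aemeasurable mf2.aestronglyMeasurable]
    exact (integral_prod_symm _ if2T).symm
  have hGint : ∫⁻ y, G y = ∫⁻ x, g2 x := by
    rw [← mT'.lintegral_comp mg2]
    exact (lintegral_prod_symm _ (mg2.comp mT'.measurable).aemeasurable).symm
  have nF : Nice F := by
    refine ⟨?_, F0, iF, ?_⟩
    · exact ((mf2.comp mT.measurable).stronglyMeasurable.integral_prod_left').measurable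
    · obtain ⟨R, hR⟩ := hf.supp
      refine ⟨R + |R| * ‖w‖, fun y hy => ?_⟩
      have : ∀ s, f2 (T (s, y)) = 0 := by
        intro s
        have : f (T (s, y)) = 0 := by
          apply hR
          by_cases hs : R < |s|
          · exact lt_of_lt_of_le hs (by
              simp [hT])
          · have h1 := norm_snd_le (T (s, y))
            have h2 := norm_sub_le (y + s • w) (s • w)
            rw [add_sub_cancel_right, norm_smul, Real.norm_eq_abs] at h2
            have h3 : |s| * ‖w‖ ≤ |R| * ‖w‖ :=
              mul_le_mul_of_nonneg_right ((not_lt.1 hs).trans (le_abs_self R)) (norm_nonneg w)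
            simp only [hT] at h1 ⊢
            linarith
        rw [hf2]; by_cases hx : T (s, y) ∈ {x : ℝ × (Fin n → ℝ) | 0 < x.1}
        · rw [Set.indicator_of_mem hx, this]
        · rw [Set.indicator_of_notMem hx]
      simp [hF, this]
  have mG : Measurable G := (mg2.comp mT'.measurable).lintegral_prod_left'
  have bF : ∀ i, ∫ y, F y * y i = 0 := by
    intro i
    set k := fun x : ℝ × (Fin n → ℝ) => f2 x * (x.2 i - x.1 * w i) with hk
    have hk' : k = Set.indicator {x : ℝ × (Fin n → ℝ) | 0 < x.1}
        (fun x => f x * (x.2 i - x.1 * w i)) := by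
      ext x
      simp only [hk, hf2, Set.indicator]
      split_ifs <;> simp
    have ik : Integrable k := by
      rw [hk']
      exact (hf.integrable_mul (by fun_prop)).indicator ms
    have ikT : Integrable (k ∘ T) := mT.integrable_comp_of_integrable ik
    have e1 : ∫ x, k x = 0 := by
      rw [hk', integral_indicator ms]; exact hw i
    have e2 : ∫ x, (k ∘ T) x = ∫ x, k x := by
      have mk : Measurable k := by rw [hk]; fun_prop
      have := integral_map (μ := volume) mT.aemeasurable
        (mk.aestronglyMeasurable (μ := Measure.map T volume))
      rw [mT.map_eq] at this
      exact this.symm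
    rw [← e1, ← e2]
    rw [Measure.volume_eq_prod, integral_prod_symm _ ikT]
    congr 1
    ext y
    rw [hF, ← integral_mul_const]
    congr 1
    ext s
    simp [hk, hT]
  have key := hP F nF bF G mG (C * (Real.pi / 4)) (by positivity) ?_
  · rw [hFint, hGint] at key
    rw [← lintegral_indicator ms, ← lintegral_indicator ms']
    have e3 : (fun x => ENNReal.ofReal (f2 x)) =
        Set.indicator {x : ℝ × (Fin n → ℝ) | 0 < x.1} (fun x => ENNReal.ofReal (f x)) := by
      rw [hf2]; ext x
      simp only [Set.indicator]; split_ifs <;> simp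
    rw [e3] at key
    refine key.trans (le_of_eq ?_)
    ring_nf
  · intro y y'
    have e1 : ENNReal.ofReal (F y) ≤ ∫⁻ s in Set.Ioi 0, ENNReal.ofReal (f (T (s, y))) := by
      refine (ofReal_integral_le _ (fun s => f20 _)).trans (le_of_eq ?_)
      rw [← lintegral_indicator measurableSet_Ioi]
      congr 1; ext s
      simp only [hf2, hT, Set.indicator, Set.mem_ofPred_eq, Set.mem_Ioi]
      split_ifs <;> simp
    have e2 : G y' = ∫⁻ t in Set.Ioi 0, g (T' (t, y')) := by
      rw [setLIntegral_congr Ioi_ae_eq_Ici, ← lintegral_indicator measurableSet_Ici]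
      change ∫⁻ t, g2 (T' (t, y')) = _
      refine lintegral_congr fun s => ?_
      simp only [hg2, hT', Set.indicator, Set.mem_ofPred_eq, Set.mem_Ici]
      simp
    rw [e2]
    refine (mul_le_mul_left e1 _).trans ?_
    refine (mult1 (C := C * Real.exp (-2 * (y ⬝ᵥ y'))) ?_ ?_ (by positivity) ?_).trans ?_
    · exact (hf.meas.comp (mT.measurable.comp (by fun_prop))).ennreal_ofReal
    · exact (hg.comp (mT'.measurable.comp (by fun_prop)))
    · intro s _ t _
      refine (h _ _).trans (le_of_eq ?_)
      rw [mul_assoc, ← Real.exp_add]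
      simp only [hT, hT', add_dotProduct, smul_dotProduct, smul_eq_mul]
      ring_nf
    · apply le_of_eq; ring_nf

end step

section step2
variable {n : ℕ}

instance instHaarProdStep : (volume : Measure (ℝ × (Fin n → ℝ))).IsAddHaarMeasure :=
  inferInstanceAs ((volume : Measure ℝ).prod (volume : Measure (Fin n → ℝ))).IsAddHaarMeasure

lemma null_slice (a : ℝ) : volume {x : ℝ × (Fin n → ℝ) | x.1 = a} = 0 := by
  have : {x : ℝ × (Fin n → ℝ) | x.1 = a} = {a} ×ˢ Set.univ := by
    ext x; simp
  rw [this, Measure.volume_eq_prod, Measure.prod_prod]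
  simp

lemma halving {f : ℝ × (Fin n → ℝ) → ℝ} (hf : Nice f) :
    ∃ a, (∫ x in {x : ℝ × (Fin n → ℝ) | a < x.1}, f x = (∫ x, f x) / 2) ∧
      (∫ x in {x : ℝ × (Fin n → ℝ) | x.1 < a}, f x = (∫ x, f x) / 2) := by
  have ms : ∀ a, MeasurableSet {x : ℝ × (Fin n → ℝ) | a < x.1} := fun a =>
    measurableSet_lt measurable_const measurable_fst
  set Φ := fun a : ℝ => ∫ x, Set.indicator {x : ℝ × (Fin n → ℝ) | a < x.1} f x with hΦ
  have hc : Continuous Φ := by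
    rw [continuous_iff_continuousAt]
    intro a
    refine continuousAt_of_dominated (bound := fun x => f x) ?_ ?_ hf.int ?_
    · exact .of_forall fun b => (hf.meas.indicator (ms b)).aestronglyMeasurable
    · refine .of_forall fun b => .of_forall fun x => ?_
      refine (norm_indicator_le_norm_self _ _).trans ?_
      rw [Real.norm_of_nonneg (hf.nonneg x)]
    · have : ∀ᵐ x : ℝ × (Fin n → ℝ), ¬ (x.1 = a) := by
        rw [ae_iff]; simpa using null_slice a
      filter_upwards [this] with x hx
      rcases lt_or_gt_of_ne hx with h | h
      · have : ∀ᶠ b in nhds a, Set.indicator {x : ℝ × (Fin n → ℝ) | b < x.1} f x = 0 := by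
          filter_upwards [lt_mem_nhds h] with b hb
          exact Set.indicator_of_notMem (by simp; exact hb.le) _
        exact (continuousAt_const (y := (0:ℝ))).congr (this.mono fun _ h => h.symm)
      · have : ∀ᶠ b in nhds a, Set.indicator {x : ℝ × (Fin n → ℝ) | b < x.1} f x = f x := by
          filter_upwards [gt_mem_nhds h] with b hb
          exact Set.indicator_of_mem (by simpa using hb) _
        exact (continuousAt_const (y := f x)).congr (this.mono fun _ h => h.symm)
  obtain ⟨R, hR⟩ := hf.supp
  have I0 : 0 ≤ ∫ x, f x := integral_nonneg hf.nonneg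
  have v1 : Φ (|R| + 1) = 0 := by
    rw [hΦ]
    refine integral_eq_zero_of_ae (.of_forall fun x => ?_)
    simp only [Set.indicator]
    split_ifs with hx
    · apply hR
      have := norm_fst_le x
      simp only [Set.mem_ofPred_eq] at hx
      rw [Real.norm_eq_abs] at this
      have := le_abs_self x.1
      have := le_abs_self R
      linarith
    · rfl
  have v2 : Φ (-|R| - 1) = ∫ x, f x := by
    rw [hΦ]
    refine integral_congr_ae (.of_forall fun x => ?_)
    simp only [Set.indicator]
    split_ifs with hx
    · rfl
    · symm
      apply hR
      have := norm_fst_le x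
      simp only [Set.mem_ofPred_eq] at hx
      rw [Real.norm_eq_abs] at this
      have := neg_abs_le x.1
      have := le_abs_self R
      linarith
  obtain ⟨a, ha⟩ := mem_range_of_exists_le_of_exists_ge hc (c := (∫ x, f x) / 2)
    ⟨|R| + 1, by rw [v1]; linarith⟩ ⟨-|R| - 1, by rw [v2]; linarith⟩
  have h1 : ∫ x in {x : ℝ × (Fin n → ℝ) | a < x.1}, f x = (∫ x, f x) / 2 := by
    rw [← integral_indicator (ms a)]; exact ha
  refine ⟨a, h1, ?_⟩
  have h2 := integral_add_compl (ms a) hf.int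
  have h3 : ∫ x in {x : ℝ × (Fin n → ℝ) | a < x.1}ᶜ, f x =
      ∫ x in {x : ℝ × (Fin n → ℝ) | x.1 < a}, f x := by
    refine setIntegral_congr_set ?_
    have : ∀ᵐ x : ℝ × (Fin n → ℝ), ¬ (x.1 = a) := by
      rw [ae_iff]; simpa using null_slice a
    filter_upwards [this] with x hx
    apply propext
    change ¬ (a < x.1) ↔ x.1 < a
    rw [not_lt]
    exact ⟨fun h => lt_of_le_of_ne h hx, le_of_lt⟩
  linarith

lemma setint_shift (a : ℝ) (z : Fin n → ℝ) (k : ℝ × (Fin n → ℝ) → ℝ) :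
    ∫ x in {x : ℝ × (Fin n → ℝ) | 0 < x.1}, k ((a, z) + x) =
      ∫ x in {x : ℝ × (Fin n → ℝ) | a < x.1}, k x := by
  rw [← integral_indicator (measurableSet_lt measurable_const measurable_fst),
    ← integral_indicator (measurableSet_lt measurable_const measurable_fst)]
  conv_rhs => rw [← integral_add_left_eq_self _ (a, z)]
  congr 1; ext x
  simp [Set.indicator]

lemma setint_shift' (a : ℝ) (z : Fin n → ℝ) (k : ℝ × (Fin n → ℝ) → ℝ) :
    ∫ x in {x : ℝ × (Fin n → ℝ) | 0 < x.1}, k ((a, z) + -x) =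
      ∫ x in {x : ℝ × (Fin n → ℝ) | x.1 < a}, k x := by
  rw [← integral_indicator (measurableSet_lt measurable_const measurable_fst),
    ← integral_indicator (measurableSet_lt measurable_fst measurable_const)]
  conv_rhs => rw [← integral_add_left_eq_self _ (a, z), ← integral_neg_eq_self]
  congr 1; ext x
  simp [Set.indicator]

lemma QQ (hP : PP n) {f : ℝ × (Fin n → ℝ) → ℝ} (hf : Nice f) :
    ∃ z : ℝ × (Fin n → ℝ), ∀ C : ℝ, 0 ≤ C → ∀ g : ℝ × (Fin n → ℝ) → ENNReal, Measurable g →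
    (∀ x y, ENNReal.ofReal (f (z + x)) * g y ≤
      ENNReal.ofReal (C * Real.exp (-2 * (x.1 * y.1 + x.2 ⬝ᵥ y.2)))) →
    (∫⁻ x, ENNReal.ofReal (f x)) * (∫⁻ y, g y) ≤ ENNReal.ofReal (C * Real.pi ^ (n + 1)) := by
  have e0 := ofReal_integral_eq_lintegral_ofReal hf.int (.of_forall hf.nonneg)
  rw [← e0]
  by_cases hI : ∫ x, f x = 0
  · exact ⟨0, fun C hC g hg h => by simp [hI]⟩
  have I0 : 0 < ∫ x, f x := lt_of_le_of_ne (integral_nonneg hf.nonneg) (Ne.symm hI)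
  obtain ⟨a, ha1, ha2⟩ := halving hf
  have ms1 : MeasurableSet {x : ℝ × (Fin n → ℝ) | a < x.1} :=
    measurableSet_lt measurable_const measurable_fst
  have ms2 : MeasurableSet {x : ℝ × (Fin n → ℝ) | x.1 < a} :=
    measurableSet_lt measurable_fst measurable_const
  set m := (∫ x, f x) / 2 with hm
  have m0 : 0 < m := by positivity
  set b1 := ∫ x in {x : ℝ × (Fin n → ℝ) | a < x.1}, f x * (x.1 - a) with hb1
  set b2 := ∫ x in {x : ℝ × (Fin n → ℝ) | x.1 < a}, f x * (x.1 - a) with hb2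
  set y1 := fun i => ∫ x in {x : ℝ × (Fin n → ℝ) | a < x.1}, f x * x.2 i with hy1
  set y2 := fun i => ∫ x in {x : ℝ × (Fin n → ℝ) | x.1 < a}, f x * x.2 i with hy2
  have ib : Integrable (fun x : ℝ × (Fin n → ℝ) => f x * (x.1 - a)) :=
    hf.integrable_mul (by fun_prop)
  have iy : ∀ i, Integrable (fun x : ℝ × (Fin n → ℝ) => f x * x.2 i) := fun i =>
    hf.integrable_mul (by fun_prop)
  have b1n : 0 ≤ b1 := setIntegral_nonneg ms1 fun x hx =>
    mul_nonneg (hf.nonneg x) (sub_nonneg.2 (le_of_lt hx))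
  have b2n : b2 ≤ 0 := setIntegral_nonpos ms2 fun x hx =>
    mul_nonpos_of_nonneg_of_nonpos (hf.nonneg x) (sub_nonpos.2 (le_of_lt hx))
  have b1p : 0 < b1 := by
    refine lt_of_le_of_ne b1n fun h0 => ?_
    have h1 := (setIntegral_eq_zero_iff_of_nonneg_ae (ae_restrict_of_forall_mem ms1 fun x hx =>
      mul_nonneg (hf.nonneg x) (sub_nonneg.2 (le_of_lt hx))) ib.integrableOn).1 h0.symm
    have h2 : ∫ x in {x : ℝ × (Fin n → ℝ) | a < x.1}, f x = 0 := by
      refine integral_eq_zero_of_ae ?_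
      filter_upwards [h1, ae_restrict_mem ms1] with x hx hx'
      have : x.1 - a ≠ 0 := sub_ne_zero.2 (ne_of_gt hx')
      simpa [this] using hx
    linarith
  set w : Fin n → ℝ := fun i => (y1 i - y2 i) / (b1 - b2) with hw
  set z : Fin n → ℝ := fun i => (y1 i - b1 * w i) / m with hz
  have hbb : b1 - b2 ≠ 0 := by linarith
  have lin1 : ∀ i, y1 i - m * z i - b1 * w i = 0 := fun i => by
    simp only [hz]; field_simp; ring
  have lin2 : ∀ i, y2 i - m * z i - b2 * w i = 0 := fun i => by
    have h1 := lin1 i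
    have h2 : (b1 - b2) * w i = y1 i - y2 i := by simp only [hw]; field_simp
    linarith
  have hsplit : ∀ (S : Set (ℝ × (Fin n → ℝ))) (i : Fin n),
      ∫ x in S, f x * (x.2 i - z i - (x.1 - a) * w i) = (∫ x in S, f x * x.2 i) -
        (∫ x in S, f x) * z i - (∫ x in S, f x * (x.1 - a)) * w i := by
    intro S i
    rw [← integral_mul_const, ← integral_mul_const, ← integral_sub, ← integral_sub]
    · congr 1; ext x; ring
    · exact (iy i).integrableOn.sub (hf.int.integrableOn.mul_const _)
    · exact ib.integrableOn.mul_const _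
    · exact (iy i).integrableOn
    · exact hf.int.integrableOn.mul_const _
  refine ⟨(a, z), fun C hC g hg h => ?_⟩
  have H1 := half hP (hf.comp_add (a, z)) w (fun i => by
    have := setint_shift a z (fun x => f x * (x.2 i - z i - (x.1 - a) * w i))
    rw [hsplit, ha1] at this
    simp only [Prod.fst_add, Prod.snd_add, Pi.add_apply, add_sub_cancel_left] at this
    rw [this]
    exact lin1 i) hg hC h
  have H2 := half hP (hf.comp_add (a, z)).comp_neg w (fun i => by
    have := setint_shift' a z (fun x => f x * (x.2 i - z i - (x.1 - a) * w i))
    rw [hsplit, ha2] at this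
    simp only [Prod.fst_add, Prod.snd_add, Pi.add_apply, add_sub_cancel_left, Prod.fst_neg,
      Prod.snd_neg, Pi.neg_apply] at this
    have e : ∀ x : ℝ × (Fin n → ℝ), f ((a, z) + -x) * (x.2 i - x.1 * w i) =
      - (f ((a, z) + -x) * (-x.2 i - -x.1 * w i)) := fun x => by ring
    simp_rw [e]
    rw [integral_neg, this]
    linarith [lin2 i]) (g := fun y => g (-y)) (hg.comp measurable_neg) hC (fun x y => by
      simpa using h (-x) (-y))
  have K1 : ∫⁻ x in {x : ℝ × (Fin n → ℝ) | 0 < x.1}, ENNReal.ofReal (f ((a, z) + x)) =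
      ENNReal.ofReal m := by
    rw [← ofReal_integral_eq_lintegral_ofReal (hf.comp_add (a, z)).int.integrableOn
      (.of_forall fun x => hf.nonneg _), setint_shift, ha1]
  have K2 : ∫⁻ x in {x : ℝ × (Fin n → ℝ) | 0 < x.1}, ENNReal.ofReal (f ((a, z) + -x)) =
      ENNReal.ofReal m := by
    rw [← ofReal_integral_eq_lintegral_ofReal (hf.comp_add (a, z)).comp_neg.int.integrableOn
      (.of_forall fun x => hf.nonneg _), setint_shift', ha2]
  rw [K1] at H1
  rw [K2] at H2
  have mdot : Measurable fun y : ℝ × (Fin n → ℝ) => y.1 + w ⬝ᵥ y.2 := by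
    unfold dotProduct; fun_prop
  have L2 : ∫⁻ y in {y : ℝ × (Fin n → ℝ) | 0 ≤ y.1 + w ⬝ᵥ y.2}, g (-y) =
      ∫⁻ y in {y : ℝ × (Fin n → ℝ) | y.1 + w ⬝ᵥ y.2 ≤ 0}, g y := by
    rw [← lintegral_indicator (measurableSet_le measurable_const mdot),
      ← lintegral_indicator (measurableSet_le mdot measurable_const)]
    conv_rhs => rw [← lintegral_neg_eq_self]
    refine lintegral_congr fun y => ?_
    have : (0 ≤ y.1 + w ⬝ᵥ y.2) ↔ ((-y).1 + (w ⬝ᵥ (-y).2) ≤ 0) := by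
      simp only [Prod.fst_neg, Prod.snd_neg, dotProduct_neg]
      constructor <;> intro <;> linarith
    simp only [Set.indicator, Set.mem_ofPred_eq, this]
  rw [L2] at H2
  have L3 : ∫⁻ y, g y ≤ (∫⁻ y in {y : ℝ × (Fin n → ℝ) | 0 ≤ y.1 + w ⬝ᵥ y.2}, g y) +
      ∫⁻ y in {y : ℝ × (Fin n → ℝ) | y.1 + w ⬝ᵥ y.2 ≤ 0}, g y := by
    rw [← setLIntegral_univ]
    refine le_trans (lintegral_mono_set ?_) (lintegral_union_le _ _ _)
    intro y _
    exact le_total (0 : ℝ) (y.1 + w ⬝ᵥ y.2)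
  have e4 : ∫ x, f x = 2 * m := by rw [hm]; ring
  rw [e4, ENNReal.ofReal_mul (by norm_num), mul_assoc]
  calc _ ≤ ENNReal.ofReal 2 * (ENNReal.ofReal (C * (Real.pi ^ (n + 1) / 4)) +
          ENNReal.ofReal (C * (Real.pi ^ (n + 1) / 4))) := by
        refine mul_le_mul_right ?_ _
        refine (mul_le_mul_right L3 _).trans ?_
        rw [mul_add]
        exact add_le_add H1 H2
    _ = _ := by
        rw [← ENNReal.ofReal_add (by positivity) (by positivity),
          ← ENNReal.ofReal_mul (by norm_num)]
        ring_nf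

end step2

section step3
variable {n : ℕ}

lemma lintegral_iSup_trunc {E : Type*} [NormedAddCommGroup E] [MeasureSpace E] [BorelSpace E]
    [SecondCountableTopology E] {g : E → ENNReal} (hg : Measurable g) :
    ∫⁻ y, g y = ⨆ k : ℕ, ∫⁻ y, (closedBall (0 : E) k).indicator (fun y => min (g y) k) y := by
  rw [← lintegral_iSup]
  · refine lintegral_congr fun y => ?_
    apply le_antisymm
    · refine (iSup_min_nat (g y)).symm.le.trans ?_
      obtain ⟨N, hN⟩ := exists_nat_ge ‖y‖
      refine iSup_le fun k => le_iSup_of_le (max N k) ?_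
      rw [Set.indicator_of_mem]
      · exact min_le_min le_rfl (by exact_mod_cast le_max_right _ _)
      · rw [mem_closedBall_zero_iff]
        exact hN.trans (by exact_mod_cast le_max_left _ _)
    · refine iSup_le fun k => ?_
      exact (Set.indicator_le_self _ _ _).trans (min_le_left _ _)
  · intro k
    exact (hg.min measurable_const).indicator measurableSet_closedBall
  · intro k l hkl y
    have hkl' : (k : ENNReal) ≤ l := by exact_mod_cast hkl
    have hkl'' : (k : ℝ) ≤ l := by exact_mod_cast hkl
    dsimp only
    by_cases hy : y ∈ closedBall (0 : E) k
    · rw [Set.indicator_of_mem hy, Set.indicator_of_mem (closedBall_subset_closedBall hkl'' hy)]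
      exact min_le_min le_rfl hkl'
    · rw [Set.indicator_of_notMem hy]
      exact zero_le

lemma PP_prod (hP : PP n) {f : ℝ × (Fin n → ℝ) → ℝ} (hf : Nice f)
    (hb1 : ∫ x, f x * x.1 = 0) (hb2 : ∀ i, ∫ x, f x * x.2 i = 0)
    {g : ℝ × (Fin n → ℝ) → ENNReal} (hg : Measurable g) {C : ℝ} (hC : 0 ≤ C)
    (h : ∀ x y, ENNReal.ofReal (f x) * g y ≤
      ENNReal.ofReal (C * Real.exp (-2 * (x.1 * y.1 + x.2 ⬝ᵥ y.2)))) :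
    (∫⁻ x, ENNReal.ofReal (f x)) * (∫⁻ y, g y) ≤ ENNReal.ofReal (C * Real.pi ^ (n + 1)) := by
  rw [lintegral_iSup_trunc hg, ENNReal.mul_iSup]
  refine iSup_le fun k => ?_
  set gk := (closedBall (0 : ℝ × (Fin n → ℝ)) k).indicator (fun y => min (g y) k) with hgk
  have mgk : Measurable gk := (hg.min measurable_const).indicator measurableSet_closedBall
  have gkk : ∀ y, gk y ≤ k := fun y => (Set.indicator_le_self _ _ _).trans (min_le_right _ _)
  have gkg : ∀ y, gk y ≤ g y := fun y => (Set.indicator_le_self _ _ _).trans (min_le_left _ _)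
  have gkt : ∀ y, gk y ≠ ⊤ := fun y => ne_top_of_le_ne_top (ENNReal.natCast_ne_top k) (gkk y)
  have hfin : ∫⁻ y, gk y ≠ ⊤ := by
    rw [hgk, lintegral_indicator measurableSet_closedBall]
    refine ne_top_of_le_ne_top ?_ (lintegral_mono fun y => min_le_right _ _)
    rw [setLIntegral_const]
    exact ENNReal.mul_ne_top (ENNReal.natCast_ne_top k) measure_closedBall_lt_top.ne
  have nk : Nice (fun y => (gk y).toReal) := by
    refine ⟨mgk.ennreal_toReal, fun _ => ENNReal.toReal_nonneg,
      integrable_toReal_of_lintegral_ne_top mgk.aemeasurable hfin, k, fun x hx => ?_⟩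
    rw [hgk, Set.indicator_of_notMem]
    · simp
    · simpa using hx
  obtain ⟨z, hz⟩ := QQ hP nk
  have cl : Continuous fun x : ℝ × (Fin n → ℝ) => x.1 * z.1 + x.2 ⬝ᵥ z.2 := by
    unfold dotProduct; fun_prop
  have := hz C hC (fun x => ENNReal.ofReal (f x * Real.exp (2 * (x.1 * z.1 + x.2 ⬝ᵥ z.2))))
    (hf.meas.mul (by have := cl.measurable; fun_prop)).ennreal_ofReal (fun y x => by
      rw [ENNReal.ofReal_toReal (gkt _), ENNReal.ofReal_mul (hf.nonneg x), ← mul_assoc,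
        mul_comm (gk _)]
      refine (mul_le_mul_left ((mul_le_mul_right (gkg _) _).trans (h x (z + y))) _).trans ?_
      rw [← ENNReal.ofReal_mul (by positivity), mul_assoc, ← Real.exp_add]
      refine ENNReal.ofReal_le_ofReal (le_of_eq ?_)
      simp only [Prod.fst_add, Prod.snd_add, dotProduct_add, dotProduct_comm y.2]
      ring_nf)
  simp only [ENNReal.ofReal_toReal (gkt _)] at this
  refine le_trans ?_ this
  rw [mul_comm]
  refine mul_le_mul_right ?_ _
  have i1 : Integrable fun x => f x * Real.exp (2 * (x.1 * z.1 + x.2 ⬝ᵥ z.2)) :=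
    hf.integrable_mul (by fun_prop)
  have i2 : Integrable fun x => f x * (x.1 * z.1 + x.2 ⬝ᵥ z.2) := hf.integrable_mul cl
  rw [← ofReal_integral_eq_lintegral_ofReal hf.int (.of_forall hf.nonneg),
    ← ofReal_integral_eq_lintegral_ofReal i1
      (.of_forall fun x => mul_nonneg (hf.nonneg x) (Real.exp_pos _).le)]
  apply ENNReal.ofReal_le_ofReal
  have z0 : ∫ x, f x * (x.1 * z.1 + x.2 ⬝ᵥ z.2) = 0 := by
    have e : ∀ x : ℝ × (Fin n → ℝ), f x * (x.1 * z.1 + x.2 ⬝ᵥ z.2) =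
        (f x * x.1) * z.1 + ∑ i, (f x * x.2 i) * z.2 i := by
      intro x
      rw [dotProduct, mul_add, Finset.mul_sum]
      congr 1
      · ring
      · exact Finset.sum_congr rfl fun i _ => by ring
    simp_rw [e]
    rw [integral_add, integral_finsetSum, integral_mul_const, hb1]
    · simp_rw [integral_mul_const, hb2]; simp
    · intro i _
      exact (hf.integrable_mul (l := fun x => x.2 i) (by fun_prop)).mul_const _
    · exact (hf.integrable_mul (l := fun x => x.1) (by fun_prop)).mul_const _
    · refine integrable_finsetSum _ fun i _ => ?_
      exact (hf.integrable_mul (l := fun x => x.2 i) (by fun_prop)).mul_const _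
  calc ∫ x, f x = ∫ x, (f x + 2 * (f x * (x.1 * z.1 + x.2 ⬝ᵥ z.2))) := by
        rw [integral_add hf.int (i2.const_mul 2), integral_const_mul, z0]; simp
    _ ≤ _ := by
        refine integral_mono (hf.int.add (i2.const_mul 2)) i1 fun x => ?_
        have := Real.add_one_le_exp (2 * (x.1 * z.1 + x.2 ⬝ᵥ z.2))
        have := mul_le_mul_of_nonneg_left this (hf.nonneg x)
        simp only
        linarith

lemma PP_succ (hP : PP n) : PP (n + 1) := by
  intro f hf hb g hg C hC h
  set e := MeasurableEquiv.piFinSuccAbove (fun _ : Fin (n + 1) => ℝ) 0 with he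
  have me : MeasurePreserving e := volume_preserving_piFinSuccAbove (fun _ : Fin (n + 1) => ℝ) 0
  have me' := me.symm
  have v0 : ∀ x : ℝ × (Fin n → ℝ), e.symm x 0 = x.1 := fun x => by
    simp [he, MeasurableEquiv.piFinSuccAbove]
  have vs : ∀ (x : ℝ × (Fin n → ℝ)) (i : Fin n), e.symm x i.succ = x.2 i := fun x i => by
    simp [he, MeasurableEquiv.piFinSuccAbove]
  have vd : ∀ x y : ℝ × (Fin n → ℝ), e.symm x ⬝ᵥ e.symm y = x.1 * y.1 + x.2 ⬝ᵥ y.2 := by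
    intro x y
    simp only [dotProduct, Fin.sum_univ_succ, v0, vs]
  have := PP_prod hP (f := fun x => f (e.symm x)) ⟨hf.meas.comp e.symm.measurable,
      fun x => hf.nonneg _, me'.integrable_comp_of_integrable hf.int, ?_⟩ ?_ ?_
      (g := fun x => g (e.symm x)) (hg.comp e.symm.measurable) hC
      (fun x y => by rw [← vd]; exact h _ _)
  · rw [me'.lintegral_comp (f := fun x => ENNReal.ofReal (f x)) hf.meas.ennreal_ofReal,
      me'.lintegral_comp hg] at this
    exact this
  · obtain ⟨R, hR⟩ := hf.supp
    refine ⟨R, fun x hx => hR _ (lt_of_lt_of_le hx ?_)⟩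
    rw [Prod.norm_def]
    refine max_le ?_ ?_
    · rw [← v0 x]; exact norm_le_pi_norm _ 0
    · refine (pi_norm_le_iff_of_nonneg (norm_nonneg _)).2 fun i => ?_
      rw [← vs x i]; exact norm_le_pi_norm _ _
  · rw [← hb 0, ← me'.integral_comp']
    simp only [v0]
  · intro i
    rw [← hb i.succ, ← me'.integral_comp']
    simp only [vs]

lemma PP_all (n : ℕ) : PP n := by
  induction n with
  | zero => exact PP_zero
  | succ n ih => exact PP_succ ih

end step3

section final

lemma PP_even (n : ℕ) {F G : (Fin n → ℝ) → ENNReal} (mF : Measurable F) (mG : Measurable G)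
    (hF : ∀ x, F (-x) = F x)
    (h : ∀ x y, F x * G y ≤ ENNReal.ofReal (Real.exp (-2 * (x ⬝ᵥ y)))) :
    (∫⁻ x, F x) * (∫⁻ y, G y) ≤ ENNReal.ofReal (Real.pi ^ n) := by
  rw [lintegral_iSup_trunc mF, ENNReal.iSup_mul]
  refine iSup_le fun k => ?_
  set gk := (closedBall (0 : Fin n → ℝ) k).indicator (fun y => min (F y) k) with hgk
  have mgk : Measurable gk := (mF.min measurable_const).indicator measurableSet_closedBall
  have gkk : ∀ y, gk y ≤ k := fun y => (Set.indicator_le_self _ _ _).trans (min_le_right _ _)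
  have gkg : ∀ y, gk y ≤ F y := fun y => (Set.indicator_le_self _ _ _).trans (min_le_left _ _)
  have gkt : ∀ y, gk y ≠ ⊤ := fun y => ne_top_of_le_ne_top (ENNReal.natCast_ne_top k) (gkk y)
  have gke : ∀ y, gk (-y) = gk y := fun y => by
    simp only [hgk, Set.indicator, mem_closedBall_zero_iff, norm_neg, hF]
  have hfin : ∫⁻ y, gk y ≠ ⊤ := by
    rw [hgk, lintegral_indicator measurableSet_closedBall]
    refine ne_top_of_le_ne_top ?_ (lintegral_mono fun y => min_le_right _ _)
    rw [setLIntegral_const]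
    exact ENNReal.mul_ne_top (ENNReal.natCast_ne_top k) measure_closedBall_lt_top.ne
  have nk : Nice (fun y => (gk y).toReal) := by
    refine ⟨mgk.ennreal_toReal, fun _ => ENNReal.toReal_nonneg,
      integrable_toReal_of_lintegral_ne_top mgk.aemeasurable hfin, k, fun x hx => ?_⟩
    rw [hgk, Set.indicator_of_notMem]
    · simp
    · simpa using hx
  have hb : ∀ i, ∫ x, (gk x).toReal * x i = 0 := fun i => by
    have e := integral_neg_eq_self (fun x : Fin n → ℝ => (gk x).toReal * x i) volume
    simp only [gke, Pi.neg_apply, mul_neg, integral_neg] at e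
    linarith
  have := PP_all n _ nk hb G mG 1 zero_le_one (fun x y => by
    rw [ENNReal.ofReal_toReal (gkt _), one_mul]
    exact (mul_le_mul_left (gkg _) _).trans (h x y))
  simpa only [ENNReal.ofReal_toReal (gkt _), one_mul] using this

lemma euclid_even (n : ℕ) {p q : EuclideanSpace ℝ (Fin n) → ℝ} (cp : Continuous p)
    (cq : Continuous q) (hp : ∀ x, p (-x) = p x) (h : ∀ x y, ⟪x, y⟫ ≤ p x * q y) :
    (∫⁻ x, ENNReal.ofReal (Real.exp (-(p x) ^ (2 : ℝ)))) *
      (∫⁻ x, ENNReal.ofReal (Real.exp (-(q x) ^ (2 : ℝ)))) ≤ ENNReal.ofReal (Real.pi ^ n) := by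
  simp only [Real.rpow_two]
  have mp : Measurable fun x => ENNReal.ofReal (Real.exp (-(p x) ^ 2)) := by
    have := cp.measurable
    fun_prop
  have mq : Measurable fun x => ENNReal.ofReal (Real.exp (-(q x) ^ 2)) := by
    have := cq.measurable
    fun_prop
  have T := PiLp.volume_preserving_toLp (Fin n)
  rw [← T.lintegral_comp mp, ← T.lintegral_comp mq]
  refine PP_even n (mp.comp T.measurable) (mq.comp T.measurable) (fun x => ?_) (fun x y => ?_)
  · simp only [WithLp.toLp_neg, hp]
  · rw [← ENNReal.ofReal_mul (Real.exp_pos _).le, ← Real.exp_add]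
    refine ENNReal.ofReal_le_ofReal (Real.exp_le_exp.2 ?_)
    have h1 := h (-WithLp.toLp 2 x) (WithLp.toLp 2 y)
    have h2 := h (WithLp.toLp 2 x) (WithLp.toLp 2 y)
    have h3 : ⟪WithLp.toLp 2 x, WithLp.toLp 2 y⟫ = x ⬝ᵥ y := by
      rw [EuclideanSpace.inner_toLp_toLp, dotProduct_comm]
      simp
    rw [h3] at h2
    nlinarith [sq_nonneg (p (WithLp.toLp 2 x) - q (WithLp.toLp 2 y))]

lemma vol_body {n : ℕ} {S : Set (EuclideanSpace ℝ (Fin (n + 1)))} (hc : Convex ℝ S)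
    (hcl : IsClosed S) (hb : Bornology.IsBounded S) (h0 : S ∈ nhds 0) (hs : ∀ x ∈ S, -x ∈ S) :
    volume S ≤ (∫⁻ x, ENNReal.ofReal (Real.exp (-(gauge S x) ^ (2 : ℝ)))) /
      ENNReal.ofReal (Real.Gamma (((n + 1 : ℕ) : ℝ) / 2 + 1)) := by
  have ab : Absorbent ℝ S := absorbent_nhds_zero h0
  have vb : Bornology.IsVonNBounded ℝ S := NormedSpace.isVonNBounded_of_isBounded ℝ hb
  have e : S = {x | gauge S x ≤ 1} := by
    ext x
    rw [Set.mem_ofPred_eq, gauge_le_one_iff_mem_closure hc h0, hcl.closure_eq]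
  have g1 := gauge_zero (s := S)
  have g2 := gauge_neg hs
  have g3 := gauge_add_le hc ab
  have g4 : ∀ {x}, gauge S x = 0 → x = 0 := fun {x} => (gauge_eq_zero ab vb).1
  have g5 : ∀ (r : ℝ) x, gauge S (r • x) ≤ |r| * gauge S x := fun r x => by
    rcases le_total 0 r with hr | hr
    · rw [gauge_smul_of_nonneg hr, abs_of_nonneg hr, smul_eq_mul]
    · rw [← g2, ← neg_smul, gauge_smul_of_nonneg (neg_nonneg.2 hr), abs_of_nonpos hr, smul_eq_mul]
  conv_lhs => rw [e]
  rw [measure_le_eq_lt volume g1 g2 g3 g4 g5,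
    measure_lt_one_eq_integral_div_gamma volume g1 g2 g3 g4 g5 (p := 2) two_pos,
    finrank_euclideanSpace_fin, ENNReal.ofReal_div_of_pos (Real.Gamma_pos_of_pos (by positivity))]
  exact ENNReal.div_le_div_right (ofReal_integral_le _ fun _ => (Real.exp_pos _).le) _

end final

/-- Blaschke–Santaló inequality (origin-symmetric case): for every origin-symmetric
convex body `K` in `ℝ^{n+1}`, the Mahler volume satisfies
`V(K)·V(K°) ≤ V(B)²`, where `B` is the closed unit ball. -/
theorem blaschke_santalo {n : ℕ} (K : Set (EuclideanSpace ℝ (Fin (n + 1))))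
    (hconv : Convex ℝ K) (hcomp : IsCompact K) (hint : (interior K).Nonempty)
    (hsymm : K = -K) :
    volume K * volume (polarBody K) ≤
      (volume (closedBall (0 : EuclideanSpace ℝ (Fin (n + 1))) 1)) ^ 2 := by
  have hs : ∀ x ∈ K, -x ∈ K := fun x hx => by
    rw [hsymm] at hx
    exact hx
  have K0 : K ∈ nhds 0 := by
    obtain ⟨x, hx⟩ := hint
    have hx' : -x ∈ interior K := by
      refine mem_interior.2 ⟨-interior K, fun y hy => ?_, isOpen_interior.neg, by simpa using hx⟩
      have := hs _ (interior_subset (Set.mem_neg.1 hy))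
      rwa [neg_neg] at this
    rw [_root_.mem_nhds_iff]
    refine ⟨interior K, interior_subset, isOpen_interior, ?_⟩
    have := hconv.interior hx hx' (a := 1 / 2) (b := 1 / 2) (by norm_num) (by norm_num)
      (by norm_num)
    simpa using this
  have Kb := hcomp.isBounded
  set L := polarBody K with hL
  have memL : ∀ y, y ∈ L ↔ ∀ x ∈ K, ⟪x, y⟫ ≤ 1 := fun y => Iff.rfl
  have Lc : Convex ℝ L := by
    intro y hy z hz a b ha hb hab x hx
    rw [inner_add_right, inner_smul_right, inner_smul_right]
    nlinarith [hy x hx, hz x hx]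
  have Lcl : IsClosed L := by
    have : L = ⋂ x ∈ K, {y | ⟪x, y⟫ ≤ 1} := by
      ext y; simp [memL]
    rw [this]
    exact isClosed_biInter fun x _ => isClosed_le (by fun_prop) continuous_const
  have Ls : ∀ y ∈ L, -y ∈ L := fun y hy x hx => by
    have := hy (-x) (hs x hx)
    rwa [inner_neg_left, ← inner_neg_right] at this
  have L0 : L ∈ nhds 0 := by
    obtain ⟨R, hR, hKR⟩ := Kb.exists_pos_norm_le
    refine Filter.mem_of_superset (closedBall_mem_nhds 0 (inv_pos.2 hR)) fun y hy x hx => ?_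
    rw [mem_closedBall_zero_iff] at hy
    calc ⟪x, y⟫ ≤ ‖x‖ * ‖y‖ := real_inner_le_norm _ _
      _ ≤ R * R⁻¹ := by gcongr; exact hKR x hx
      _ = 1 := mul_inv_cancel₀ hR.ne'
  have Lb : Bornology.IsBounded L := by
    obtain ⟨r, hr, hKr⟩ := Metric.nhds_basis_closedBall.mem_iff.1 K0
    refine (isBounded_closedBall (x := 0) (r := r⁻¹)).subset fun y hy => ?_
    rw [mem_closedBall_zero_iff]
    by_cases hy0 : y = 0
    · simp [hy0, hr.le]
    have hn : 0 < ‖y‖ := norm_pos_iff.2 hy0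
    have := hy ((r / ‖y‖) • y) (hKr (by
      rw [mem_closedBall_zero_iff, norm_smul, Real.norm_of_nonneg (by positivity),
        div_mul_cancel₀ _ hn.ne']))
    rw [real_inner_smul_left, real_inner_self_eq_norm_sq] at this
    have e : r / ‖y‖ * ‖y‖ ^ 2 = r * ‖y‖ := by field_simp
    rw [e] at this
    rw [← one_div, le_div_iff₀ hr]
    linarith
  have dual : ∀ x y, ⟪x, y⟫ ≤ gauge K x * gauge L y := by
    intro x y
    have key : ∀ a > gauge K x, ∀ b > gauge L y, ⟪x, y⟫ ≤ a * b := by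
      intro a ha b hb
      obtain ⟨a', ha0, haa, x', hx', rfl⟩ := exists_lt_of_gauge_lt (absorbent_nhds_zero K0) ha
      obtain ⟨b', hb0, hbb, y', hy', rfl⟩ := exists_lt_of_gauge_lt (absorbent_nhds_zero L0) hb
      simp only [real_inner_smul_left, real_inner_smul_right]
      have := hy' x' hx'
      calc b' * (a' * ⟪x', y'⟫) ≤ b' * (a' * 1) := by gcongr
        _ = a' * b' := by ring
        _ ≤ a * b := mul_le_mul haa.le hbb.le hb0.le (ha0.trans haa).le
    have t : Filter.Tendsto (fun ε : ℝ => (gauge K x + ε) * (gauge L y + ε)) (nhdsWithin 0 (Set.Ioi 0))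
        (nhds ((gauge K x + 0) * (gauge L y + 0))) :=
      ((by fun_prop : Continuous fun ε : ℝ => (gauge K x + ε) * (gauge L y + ε)).tendsto 0).mono_left
        nhdsWithin_le_nhds
    rw [add_zero, add_zero] at t
    refine ge_of_tendsto t (Filter.eventually_of_mem self_mem_nhdsWithin fun ε hε => ?_)
    have hε' : (0 : ℝ) < ε := hε
    exact key _ (by linarith) _ (by linarith)
  have vK := vol_body hconv hcomp.isClosed Kb K0 hs
  have vL := vol_body Lc Lcl Lb L0 Ls
  have main := euclid_even (n + 1) (continuous_gauge hconv K0) (continuous_gauge Lc L0)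
    (gauge_neg hs) dual
  refine (mul_le_mul' vK vL).trans ?_
  have Gp : 0 < Real.Gamma (((n + 1 : ℕ) : ℝ) / 2 + 1) := Real.Gamma_pos_of_pos (by positivity)
  rw [EuclideanSpace.volume_closedBall, Fintype.card_fin, ENNReal.ofReal_one, one_pow, one_mul,
    ENNReal.ofReal_div_of_pos Gp]
  simp only [div_eq_mul_inv]
  rw [mul_mul_mul_comm, mul_pow, ← ENNReal.ofReal_pow (by positivity), ← pow_mul, mul_comm (n + 1) 2,
    pow_mul, Real.sq_sqrt Real.pi_pos.le, sq]
  exact mul_le_mul_left main _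
end

section
/- Equality case of the Blaschke–Santaló inequality: if an origin-symmetric convex body K in ℝ^{n+1} satisfies V(K)·V(K°) = V(B)², then K is an origin-centered ellipsoid, i.e. there exists an invertible linear map A : ℝ^{n+1} → ℝ^{n+1} with K = A(B). -/
open MeasureTheory Metric
open scoped RealInnerProductSpace

section Part1
open MeasureTheory Metric Set
open scoped RealInnerProductSpace ENNReal Pointwise

lemma bm_compact (A B S : Set ℝ) (hA : IsCompact A) (hB : IsCompact B)
    (nA : A.Nonempty) (nB : B.Nonempty)
    (h : ∀ a ∈ A, ∀ b ∈ B, (a + b) / 2 ∈ S) : volume A + volume B ≤ 2 * volume S := by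
  obtain ⟨M, hM, hM'⟩ := hA.exists_isGreatest nA
  obtain ⟨m, hm, hm'⟩ := hB.exists_isLeast nB
  have e2 : volume ((fun x : ℝ => 2⁻¹ * x) ⁻¹' S) = 2 * volume S := by
    rw [Real.volume_preimage_mul_left (by norm_num)]
    norm_num
  have e3 : volume A = volume ((fun x => x + m) '' A) := by
    simp
  have e4 : volume B = volume (((fun x => x + M) '' B) \ {M + m}) := by
    rw [measure_sdiff_null (by simp)]
    simp
  rw [← e2, e3, e4, ← measure_union']
  · apply measure_mono
    rintro x (⟨a, ha, rfl⟩ | ⟨⟨b, hb, rfl⟩, -⟩)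
    · have := h a ha m hm
      simpa [div_eq_inv_mul] using this
    · have := h M hM b hb
      simpa [div_eq_inv_mul, add_comm] using this
  · rw [Set.disjoint_left]
    rintro x ⟨a, ha, rfl⟩ ⟨⟨b, hb, hab⟩, hne⟩
    have h1 := hM' ha
    have h2 := hm' hb
    simp only [mem_singleton_iff] at hne hab
    apply hne
    linarith
  · exact (hA.image (by fun_prop)).measurableSet

lemma bm_meas (A B S : Set ℝ) (hA : MeasurableSet A) (hB : MeasurableSet B)
    (nA : A.Nonempty) (nB : B.Nonempty)
    (h : ∀ a ∈ A, ∀ b ∈ B, (a + b) / 2 ∈ S) : volume A + volume B ≤ 2 * volume S := by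
  obtain ⟨a, ha⟩ := nA
  obtain ⟨b, hb⟩ := nB
  rw [hA.measure_eq_iSup_isCompact, hB.measure_eq_iSup_isCompact]
  simp only [iSup_and']
  refine ENNReal.biSup_add_biSup_le' ⟨∅, by simp⟩ ⟨∅, by simp⟩ ?_
  rintro C ⟨hC, hC'⟩ D ⟨hD, hD'⟩
  calc volume C + volume D ≤ volume (insert a C) + volume (insert b D) := by
        gcongr <;> simp
    _ ≤ _ := by
        refine bm_compact _ _ _ (hC'.insert a) (hD'.insert b) (by simp) (by simp) ?_
        intro x hx y hy
        exact h x (Set.insert_subset ha hC hx) y (Set.insert_subset hb hD hy)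

/-- Prékopa–Leindler property with parameter one half. -/
def PL (X : Type*) [AddCommGroup X] [Module ℝ X] [MeasureSpace X] : Prop :=
  ∀ f g h : X → ℝ≥0∞, Measurable f → Measurable g → Measurable h →
    (∀ x y, f x * g y ≤ h ((2⁻¹ : ℝ) • (x + y)) ^ 2) →
    (∫⁻ x, f x) * (∫⁻ x, g x) ≤ (∫⁻ x, h x) ^ 2

lemma pl_norm_s1 (f g h : ℝ → ℝ) (mf : Measurable f) (mg : Measurable g) (mh : Measurable h)
    (f0 : ∀ x, 0 ≤ f x) (g0 : ∀ x, 0 ≤ g x) (h0 : ∀ x, 0 ≤ h x)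
    (f1 : ∀ x, f x ≤ 1) (g1 : ∀ x, g x ≤ 1)
    (fs : ∀ r < 1, ∃ x, r < f x) (gs : ∀ r < 1, ∃ x, r < g x)
    (H : ∀ x y, f x * g y ≤ h ((x + y) / 2) ^ 2) :
    (∫⁻ x, ENNReal.ofReal (f x)) + (∫⁻ x, ENNReal.ofReal (g x)) ≤
      2 * ∫⁻ x, ENNReal.ofReal (h x) := by
  rw [lintegral_eq_lintegral_meas_lt _ (.of_forall f0) mf.aemeasurable,
    lintegral_eq_lintegral_meas_lt _ (.of_forall g0) mg.aemeasurable,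
    lintegral_eq_lintegral_meas_lt _ (.of_forall h0) mh.aemeasurable]
  have an : ∀ u : ℝ → ℝ, Measurable (fun t => volume {a | t < u a}) := by
    intro u
    apply Antitone.measurable
    intro s t hst
    apply measure_mono
    intro x hx
    exact lt_of_le_of_lt hst hx
  rw [← lintegral_add_left (an f), ← lintegral_const_mul _ (an h)]
  apply setLIntegral_mono ((an h).const_mul 2)
  intro t ht
  have ht : 0 < t := ht
  rcases lt_or_ge t 1 with h1 | h1
  · refine bm_meas _ _ _ (measurableSet_lt measurable_const mf)
      (measurableSet_lt measurable_const mg) (fs t h1) (gs t h1) ?_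
    intro a ha b hb
    simp only [mem_ofPred_eq] at ha hb ⊢
    have := H a b
    by_contra hc
    push Not at hc
    have := h0 ((a+b)/2)
    nlinarith
  · have e1 : {a | t < f a} = ∅ := by
      ext x; simp; linarith [f1 x]
    have e2 : {a | t < g a} = ∅ := by
      ext x; simp; linarith [g1 x]
    rw [e1, e2]; simp

lemma ennreal_amgm (a b c : ℝ≥0∞) (h : a + b ≤ 2 * c) : a * b ≤ c ^ 2 := by
  by_cases hc : c = ∞
  · simp [hc]
  have h2 : 2 * c ≠ ∞ := ENNReal.mul_ne_top (by simp) hc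
  have ha : a ≠ ∞ := ne_top_of_le_ne_top h2 (le_self_add.trans h)
  have hb : b ≠ ∞ := ne_top_of_le_ne_top h2 (le_add_self.trans h)
  lift a to NNReal using ha
  lift b to NNReal using hb
  lift c to NNReal using hc
  norm_cast at *
  have h' : (a : ℝ) + b ≤ 2 * c := by exact_mod_cast h
  have : (a : ℝ) * b ≤ c ^ 2 := by
    nlinarith [sq_nonneg ((a : ℝ) - b), a.2, b.2, c.2, NNReal.coe_nonneg a, NNReal.coe_nonneg b]
  exact_mod_cast this

lemma pl_bdd_s1 (f g h : ℝ → ℝ≥0∞) (mf : Measurable f) (mg : Measurable g) (mh : Measurable h)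
    (k : ℝ≥0∞) (hk : k ≠ ∞) (fk : ∀ x, f x ≤ k) (gk : ∀ x, g x ≤ k)
    (H : ∀ x y, f x * g y ≤ h ((x + y) / 2) ^ 2) :
    (∫⁻ x, f x) * (∫⁻ x, g x) ≤ (∫⁻ x, h x) ^ 2 := by
  set a := ⨆ x, f x with ha
  set b := ⨆ x, g x with hb
  have fa : ∀ x, f x ≤ a := fun x => le_iSup f x
  have gb : ∀ x, g x ≤ b := fun x => le_iSup g x
  have at' : a ≠ ∞ := ne_top_of_le_ne_top hk (iSup_le fk)
  have bt' : b ≠ ∞ := ne_top_of_le_ne_top hk (iSup_le gk)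
  by_cases a0 : a = 0
  · have : ∀ x, f x = 0 := fun x => by simpa [a0] using fa x
    simp [this]
  by_cases b0 : b = 0
  · have : ∀ x, g x = 0 := fun x => by simpa [b0] using gb x
    simp [this]
  obtain ⟨c, hc⟩ : ∃ c : ℝ≥0∞, c ^ 2 = a * b := by
    refine ⟨(a * b) ^ (1/2 : ℝ), ?_⟩
    rw [← ENNReal.rpow_natCast, ← ENNReal.rpow_mul]
    norm_num
  have c0 : c ≠ 0 := by
    rintro rfl
    simp [a0, b0] at hc
  have ct : c ≠ ∞ := by
    rintro rfl
    have := ENNReal.mul_ne_top at' bt'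
    simp [← hc] at this
  have main := pl_norm_s1 (fun x => (f x / a).toReal) (fun x => (g x / b).toReal)
    (fun x => (min (h x / c) 1).toReal) (by fun_prop) (by fun_prop)
    (by
      apply Measurable.ennreal_toReal
      exact (mh.div_const c).min measurable_const)
    (fun x => ENNReal.toReal_nonneg) (fun x => ENNReal.toReal_nonneg)
    (fun x => ENNReal.toReal_nonneg) ?_ ?_ ?_ ?_ ?_
  · have ef : ∀ x, ENNReal.ofReal (f x / a).toReal = f x / a := fun x =>
      ENNReal.ofReal_toReal (ENNReal.div_ne_top (ne_top_of_le_ne_top at' (fa x)) a0)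
    have eg : ∀ x, ENNReal.ofReal (g x / b).toReal = g x / b := fun x =>
      ENNReal.ofReal_toReal (ENNReal.div_ne_top (ne_top_of_le_ne_top bt' (gb x)) b0)
    have eh : ∀ x, ENNReal.ofReal (min (h x / c) 1).toReal ≤ h x / c := fun x => by
      rw [ENNReal.ofReal_toReal (ne_top_of_le_ne_top ENNReal.one_ne_top (min_le_right _ _))]
      exact min_le_left _ _
    have m2 := main.trans (mul_le_mul_right (lintegral_mono eh) 2)
    simp only [ef, eg] at m2
    simp only [div_eq_mul_inv] at m2
    rw [lintegral_mul_const _ mf, lintegral_mul_const _ mg, lintegral_mul_const _ mh] at m2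
    have m3 := ennreal_amgm _ _ _ m2
    calc (∫⁻ x, f x) * (∫⁻ x, g x) = ((∫⁻ x, f x) * a⁻¹ * ((∫⁻ x, g x) * b⁻¹)) * (a * b) := by
          have e1 := ENNReal.inv_mul_cancel a0 at'
          have e2 := ENNReal.inv_mul_cancel b0 bt'
          calc _ = (∫⁻ x, f x) * (a⁻¹ * a) * ((∫⁻ x, g x) * (b⁻¹ * b)) := by simp [e1, e2]
            _ = _ := by ring
      _ ≤ ((∫⁻ x, h x) * c⁻¹) ^ 2 * (a * b) := by gcongr
      _ = _ := by
          rw [← hc, ← mul_pow, mul_assoc, ENNReal.inv_mul_cancel c0 ct, mul_one]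
  · intro x
    have : f x / a ≤ 1 := ENNReal.div_le_of_le_mul (by simpa using fa x)
    exact ENNReal.toReal_mono ENNReal.one_ne_top this
  · intro x
    have : g x / b ≤ 1 := ENNReal.div_le_of_le_mul (by simpa using gb x)
    exact ENNReal.toReal_mono ENNReal.one_ne_top this
  · intro r hr
    by_contra hcon
    push Not at hcon
    have : a ≤ ENNReal.ofReal r * a := by
      apply iSup_le
      intro x
      have := hcon x
      rw [← ENNReal.le_ofReal_iff_toReal_le (ENNReal.div_ne_top (ne_top_of_le_ne_top at' (fa x)) a0)
        (ENNReal.toReal_nonneg.trans this)] at this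
      rwa [ENNReal.div_le_iff a0 at'] at this
    have h2 : ENNReal.ofReal r * a < 1 * a := by
      rw [ENNReal.mul_lt_mul_iff_left a0 at']
      simpa using hr
    rw [one_mul] at h2
    exact absurd this (not_le.mpr h2)
  · intro r hr
    by_contra hcon
    push Not at hcon
    have : b ≤ ENNReal.ofReal r * b := by
      apply iSup_le
      intro x
      have := hcon x
      rw [← ENNReal.le_ofReal_iff_toReal_le (ENNReal.div_ne_top (ne_top_of_le_ne_top bt' (gb x)) b0)
        (ENNReal.toReal_nonneg.trans this)] at this
      rwa [ENNReal.div_le_iff b0 bt'] at this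
    have h2 : ENNReal.ofReal r * b < 1 * b := by
      rw [ENNReal.mul_lt_mul_iff_left b0 bt']
      simpa using hr
    rw [one_mul] at h2
    exact absurd this (not_le.mpr h2)
  · intro x y
    rw [← ENNReal.toReal_mul, ← ENNReal.toReal_pow]
    have ff : f x / a ≤ 1 := ENNReal.div_le_of_le_mul (by simpa using fa x)
    have gg : g y / b ≤ 1 := ENNReal.div_le_of_le_mul (by simpa using gb y)
    apply ENNReal.toReal_mono
    · exact ENNReal.pow_ne_top (ne_top_of_le_ne_top ENNReal.one_ne_top (min_le_right _ _))
    rcases le_total (h ((x+y)/2) / c) 1 with hh | hh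
    · rw [min_eq_left hh]
      calc f x / a * (g y / b) = f x * g y * (a * b)⁻¹ := by
            rw [ENNReal.mul_inv (Or.inl a0) (Or.inl at'), div_eq_mul_inv, div_eq_mul_inv]
            ring
        _ ≤ h ((x+y)/2) ^ 2 * (a * b)⁻¹ := by gcongr; exact H x y
        _ = _ := by
            rw [← hc, div_eq_mul_inv (h _), mul_pow, ENNReal.inv_pow]
    · rw [min_eq_right hh]
      simpa using mul_le_mul' ff gg

lemma pl_real : PL ℝ := by
  intro f g h mf mg mh H
  have H' : ∀ x y, f x * g y ≤ h ((x + y) / 2) ^ 2 := by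
    intro x y
    have := H x y
    rwa [smul_eq_mul, ← div_eq_inv_mul] at this
  have tr : ∀ u : ℝ → ℝ≥0∞, Measurable u →
      ∫⁻ x, u x = ⨆ k : ℕ, ∫⁻ x, min (u x) k := by
    intro u mu
    rw [← lintegral_iSup (fun k => mu.min measurable_const)]
    · congr 1
      ext x
      rw [← inf_iSup_eq, ENNReal.iSup_natCast]
      simp
    · intro i j hij x
      exact min_le_min le_rfl (by exact_mod_cast hij)
  have mono : ∀ u : ℝ → ℝ≥0∞, Monotone (fun k : ℕ => ∫⁻ x, min (u x) k) := by
    intro u i j hij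
    apply lintegral_mono
    intro x
    exact min_le_min le_rfl (by exact_mod_cast hij)
  rw [tr f mf, tr g mg, ENNReal.iSup_mul]
  apply iSup_le
  intro i
  rw [ENNReal.mul_iSup]
  apply iSup_le
  intro j
  calc _ ≤ (∫⁻ x, min (f x) ((max i j : ℕ) : ℝ≥0∞)) * (∫⁻ x, min (g x) ((max i j : ℕ) : ℝ≥0∞)) :=
        mul_le_mul' (mono f (le_max_left _ _)) (mono g (le_max_right _ _))
    _ ≤ _ := by
        refine pl_bdd_s1 _ _ h (mf.min measurable_const) (mg.min measurable_const) mh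
          ((max i j : ℕ) : ℝ≥0∞) (ENNReal.natCast_ne_top _) (fun x => min_le_right _ _)
          (fun x => min_le_right _ _) ?_
        intro x y
        exact (mul_le_mul' (min_le_left _ _) (min_le_left _ _)).trans (H' x y)

lemma pl_prod {X Y : Type*} [AddCommGroup X] [Module ℝ X] [MeasureSpace X]
    [AddCommGroup Y] [Module ℝ Y] [MeasureSpace Y] [SFinite (volume : Measure X)]
    [SFinite (volume : Measure Y)] (hX : PL X) (hY : PL Y) : PL (X × Y) := by
  intro f g h mf mg mh H
  rw [Measure.volume_eq_prod, lintegral_prod _ mf.aemeasurable, lintegral_prod _ mg.aemeasurable,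
    lintegral_prod _ mh.aemeasurable]
  refine hX _ _ _ mf.lintegral_prod_right' mg.lintegral_prod_right' mh.lintegral_prod_right' ?_
  intro x y
  refine hY _ _ _ (by fun_prop) (by fun_prop) (by fun_prop) ?_
  intro u v
  exact H (x, u) (y, v)

lemma pl_fin (n : ℕ) : PL (Fin n → ℝ) := by
  induction n with
  | zero =>
    intro f g h mf mg mh H
    rw [Measure.volume_pi_eq_dirac 0]
    rw [lintegral_dirac, lintegral_dirac, lintegral_dirac]
    simpa using H 0 0
  | succ n ih =>
    intro f g h mf mg mh H
    have mp := (volume_preserving_piFinSuccAbove (fun _ : Fin (n+1) => ℝ) 0).symm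
    rw [← mp.lintegral_comp mf, ← mp.lintegral_comp mg, ← mp.lintegral_comp mh]
    refine pl_prod pl_real ih _ _ _ (mf.comp mp.measurable) (mg.comp mp.measurable)
      (mh.comp mp.measurable) ?_
    intro x y
    refine (H _ _).trans (le_of_eq ?_)
    congr 2
    ext i
    refine Fin.cases ?_ (fun i => ?_) i <;> simp [MeasurableEquiv.piFinSuccAbove, mul_add]

lemma pl_sets {X : Type*} [AddCommGroup X] [Module ℝ X] [MeasureSpace X] [MeasurableNeg X]
    (hX : PL X) (hneg : ∀ s : Set X, volume (-s) = volume s)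
    (C S : Set X) (hC : MeasurableSet C) (hS : MeasurableSet S)
    (h : ∀ a ∈ C, ∀ b ∈ C, (2⁻¹ : ℝ) • (a - b) ∈ S) : volume C ≤ volume S := by
  have := hX (C.indicator 1) ((-C).indicator 1) (S.indicator 1)
    (measurable_one.indicator hC) (measurable_one.indicator hC.neg) (measurable_one.indicator hS) ?_
  · rw [lintegral_indicator_one hC, lintegral_indicator_one hC.neg, lintegral_indicator_one hS,
      hneg, ← sq] at this
    exact (ENNReal.pow_le_pow_left_iff (n := 2) (by norm_num)).1 this
  · intro x y
    by_cases hx : x ∈ C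
    · by_cases hy : y ∈ -C
      · have := h x hx (-y) hy
        rw [sub_neg_eq_add] at this
        rw [Set.indicator_of_mem hx, Set.indicator_of_mem hy, Set.indicator_of_mem this]
        simp
      · simp [hy]
    · simp [hx]

end Part1

section Part2
open MeasureTheory Metric Set
open scoped RealInnerProductSpace ENNReal Pointwise

lemma fiber_lemma {X Y : Type*} [AddCommGroup Y] [Module ℝ Y] [MeasureSpace X] [MeasureSpace Y]
    [SFinite (volume : Measure X)] [SFinite (volume : Measure Y)] [MeasurableNeg Y]
    (hY : PL Y) (hneg : ∀ s : Set Y, volume (-s) = volume s)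
    (D S : Set (X × Y)) (hD : MeasurableSet D) (hS : MeasurableSet S)
    (h : ∀ x z w, (x, z) ∈ D → (x, w) ∈ D → (x, (2⁻¹ : ℝ) • (z - w)) ∈ S) :
    volume D ≤ volume S := by
  rw [Measure.volume_eq_prod, Measure.prod_apply hD, Measure.prod_apply hS]
  apply lintegral_mono
  intro x
  refine pl_sets hY hneg _ _ (measurable_prodMk_left hD) (measurable_prodMk_left hS) ?_
  intro a ha b hb
  exact h x a b ha hb

/-- gluing map -/
noncomputable def glue {n : ℕ} (q : ℝ × (Fin n → ℝ)) : EuclideanSpace ℝ (Fin (n+1)) :=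
  WithLp.toLp 2 (Fin.cons q.1 q.2 : Fin (n+1) → ℝ)

lemma glue_mp (n : ℕ) : MeasurePreserving (glue (n := n)) := by
  have h1 := (volume_preserving_piFinSuccAbove (fun _ : Fin (n+1) => ℝ) 0).symm
  have h2 := PiLp.volume_preserving_toLp (Fin (n+1))
  have := h2.comp h1
  convert this using 1
  ext q i
  refine Fin.cases ?_ (fun i => ?_) i <;> simp [glue, MeasurableEquiv.piFinSuccAbove]

lemma glue_mp' (n : ℕ) : MeasurePreserving (fun q : (Fin n → ℝ) × ℝ => glue (q.2, q.1)) :=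
  (glue_mp n).comp (Measure.measurePreserving_swap)

lemma vol_sec_one {n : ℕ} (D S : Set (EuclideanSpace ℝ (Fin (n+1))))
    (hD : MeasurableSet D) (hS : MeasurableSet S)
    (h : ∀ a ∈ D, ∀ b ∈ D, (∀ i : Fin n, a i.succ = b i.succ) → ∀ v : EuclideanSpace ℝ (Fin (n+1)),
      v 0 = (a 0 - b 0) / 2 → (∀ i : Fin n, v i.succ = a i.succ) → v ∈ S) :
    volume D ≤ volume S := by
  rw [← (glue_mp' n).measure_preimage hD.nullMeasurableSet,
    ← (glue_mp' n).measure_preimage hS.nullMeasurableSet]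
  refine fiber_lemma pl_real (fun s => Measure.measure_neg _ s) _ _ ((glue_mp' n).measurable hD)
    ((glue_mp' n).measurable hS) ?_
  intro x z w hz hw
  refine h _ hz _ hw (by simp [glue]) _ (by simp [glue]; ring) (by simp [glue])

lemma vol_sec_two {n : ℕ} (D S : Set (EuclideanSpace ℝ (Fin (n+1))))
    (hD : MeasurableSet D) (hS : MeasurableSet S)
    (h : ∀ a ∈ D, ∀ b ∈ D, a 0 = b 0 → ∀ v : EuclideanSpace ℝ (Fin (n+1)),
      v 0 = a 0 → (∀ i : Fin n, v i.succ = (a i.succ - b i.succ) / 2) → v ∈ S) :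
    volume D ≤ volume S := by
  rw [← (glue_mp n).measure_preimage hD.nullMeasurableSet,
    ← (glue_mp n).measure_preimage hS.nullMeasurableSet]
  refine fiber_lemma (pl_fin n) (fun s => Measure.measure_neg _ s) _ _ ((glue_mp n).measurable hD)
    ((glue_mp n).measurable hS) ?_
  intro x z w hz hw
  refine h _ hz _ hw (by simp [glue]) _ (by simp [glue]) (by simp [glue]; intro i; ring)

end Part2

section Part3
open MeasureTheory Metric Set
open scoped RealInnerProductSpace ENNReal Pointwise

/-- symmetric convex bodies -/
structure SCB {n : ℕ} (K : Set (EuclideanSpace ℝ (Fin (n+1)))) : Prop where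
  conv : Convex ℝ K
  comp : IsCompact K
  zero : (0 : EuclideanSpace ℝ (Fin (n+1))) ∈ interior K
  symm : ∀ x ∈ K, -x ∈ K

/-- maximizers of the volume product -/
def IsMx {n : ℕ} (K : Set (EuclideanSpace ℝ (Fin (n+1)))) : Prop :=
  SCB K ∧ ∀ L : Set (EuclideanSpace ℝ (Fin (n+1))), SCB L →
    volume L * volume (polarBody L) ≤ volume K * volume (polarBody K)

section
variable {n : ℕ} {K : Set (EuclideanSpace ℝ (Fin (n+1)))}

lemma SCB.ball (h : SCB K) : ∃ r > 0, ball 0 r ⊆ K := by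
  obtain ⟨r, hr, h⟩ := Metric.isOpen_iff.1 isOpen_interior _ h.zero
  exact ⟨r, hr, h.trans interior_subset⟩

lemma SCB.cball (h : SCB K) : ∃ r > 0, closedBall 0 r ⊆ K := by
  obtain ⟨r, hr, h⟩ := h.ball
  exact ⟨r/2, by positivity, (closedBall_subset_ball (by linarith)).trans h⟩

lemma SCB.bdd (h : SCB K) : ∃ R > 0, K ⊆ closedBall 0 R := by
  obtain ⟨R, hR, h⟩ := h.comp.isBounded.subset_closedBall_lt 0 0
  exact ⟨R, hR, h⟩

lemma zero_interior_of_ball {r : ℝ} (hr : 0 < r) (h : ball 0 r ⊆ K) :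
    (0 : EuclideanSpace ℝ (Fin (n+1))) ∈ interior K :=
  interior_maximal h isOpen_ball (mem_ball_self hr)

lemma SCB.polar (h : SCB K) : SCB (polarBody K) := by
  obtain ⟨r, hr, hrK⟩ := h.cball
  obtain ⟨R, hR, hRK⟩ := h.bdd
  refine ⟨?_, ?_, ?_, ?_⟩
  · intro x hx y hy a b ha hb hab z hz
    have h1 := hx z hz
    have h2 := hy z hz
    rw [inner_add_right, inner_smul_right, inner_smul_right]
    nlinarith
  · apply isCompact_of_isClosed_isBounded
    · have : polarBody K = ⋂ x ∈ K, {y | ⟪x, y⟫ ≤ 1} := by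
        ext y; simp [polarBody]
      rw [this]
      exact isClosed_biInter fun x _ => isClosed_le (by fun_prop) (by fun_prop)
    · refine (isBounded_closedBall (x := (0 : EuclideanSpace ℝ (Fin (n+1)))) (r := r⁻¹)).subset ?_
      intro y hy
      rw [mem_closedBall_zero_iff]
      by_cases h0 : y = 0
      · simp [h0]; positivity
      have hy0 : 0 < ‖y‖ := norm_pos_iff.2 h0
      have := hy ((r / ‖y‖) • y) (hrK (by
        rw [mem_closedBall_zero_iff, norm_smul, Real.norm_of_nonneg (by positivity)]
        field_simp; rfl))
      rw [real_inner_smul_left, real_inner_self_eq_norm_sq] at this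
      have e : r / ‖y‖ * ‖y‖^2 = r * ‖y‖ := by field_simp
      rw [e] at this
      rw [← one_div, le_div_iff₀ hr]; linarith
  · apply zero_interior_of_ball (r := R⁻¹) (by positivity)
    intro y hy x hx
    have hx' := hRK hx
    rw [mem_closedBall_zero_iff] at hx'
    rw [mem_ball_zero_iff] at hy
    calc ⟪x, y⟫ ≤ ‖x‖ * ‖y‖ := real_inner_le_norm x y
      _ ≤ R * R⁻¹ := by gcongr
      _ = 1 := by field_simp
  · intro y hy x hx
    have := hy (-x) (h.symm x hx)
    rw [inner_neg_left] at this
    rwa [inner_neg_right]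

lemma SCB.vol_pos (h : SCB K) : 0 < volume K :=
  (isOpen_interior.measure_pos volume ⟨0, h.zero⟩).trans_le (measure_mono interior_subset)

lemma SCB.vol_ne_top (h : SCB K) : volume K ≠ ∞ := h.comp.measure_lt_top.ne

lemma eq_of_vol {A B : Set (EuclideanSpace ℝ (Fin (n+1)))} (hAB : A ⊆ B) (hA : IsCompact A)
    (hB : SCB B) (hv : volume B ≤ volume A) : B ⊆ A := by
  have h0 : volume (B \ A) = 0 := by
    rw [measure_sdiff hAB hA.measurableSet.nullMeasurableSet hA.measure_lt_top.ne]
    exact tsub_eq_zero_of_le hv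
  have h1 : volume (interior B \ A) = 0 :=
    measure_mono_null (sdiff_subset_sdiff_left interior_subset) h0
  have h2 : interior B \ A = ∅ := by
    rwa [(isOpen_interior.sdiff hA.isClosed).measure_eq_zero_iff (μ := volume)] at h1
  have h3 : interior B ⊆ A := by
    rwa [sdiff_eq_empty] at h2
  have h4 := hB.conv.closure_interior_eq_closure_of_nonempty_interior ⟨0, hB.zero⟩
  calc B ⊆ closure B := subset_closure
    _ = closure (interior B) := h4.symm
    _ ⊆ A := closure_minimal h3 hA.isClosed

/-- reflect the zeroth coordinate and average -/
noncomputable def avgMap (n : ℕ) : EuclideanSpace ℝ (Fin (n+1)) × EuclideanSpace ℝ (Fin (n+1)) →ₗ[ℝ]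
    EuclideanSpace ℝ (Fin (n+1)) where
  toFun q := WithLp.toLp 2 (Fin.cons ((q.1 0 - q.2 0) / 2) (fun i => (q.1 i.succ + q.2 i.succ) / 2) :
    Fin (n+1) → ℝ)
  map_add' p q := by
    ext i
    refine Fin.cases ?_ (fun i => ?_) i <;> simp <;> ring
  map_smul' p q := by
    ext i
    refine Fin.cases ?_ (fun i => ?_) i <;> simp <;> ring

@[simp] lemma avgMap_zero (q) : avgMap n q 0 = (q.1 0 - q.2 0) / 2 := by simp [avgMap]
@[simp] lemma avgMap_succ (q) (i : Fin n) : avgMap n q i.succ = (q.1 i.succ + q.2 i.succ) / 2 := by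
  simp [avgMap]

/-- first type of symmetrization -/
def symA (K : Set (EuclideanSpace ℝ (Fin (n+1)))) : Set (EuclideanSpace ℝ (Fin (n+1))) :=
  avgMap n '' ((K ×ˢ K) ∩ {q | ∀ i : Fin n, q.1 i.succ = q.2 i.succ})

/-- second type of symmetrization -/
def symB (K : Set (EuclideanSpace ℝ (Fin (n+1)))) : Set (EuclideanSpace ℝ (Fin (n+1))) :=
  avgMap n '' ((K ×ˢ K) ∩ {q | q.2 0 = - q.1 0})

lemma norm_reflect (v : EuclideanSpace ℝ (Fin (n+1))) :
    ‖(WithLp.toLp 2 (Fin.cons (-(v 0)) (fun i => v i.succ) : Fin (n+1) → ℝ) :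
      EuclideanSpace ℝ (Fin (n+1)))‖ = ‖v‖ := by
  simp [EuclideanSpace.norm_eq, Fin.sum_univ_succ]

lemma SCB.symA (h : SCB K) : SCB (symA K) := by
  obtain ⟨r, hr, hrK⟩ := h.ball
  refine ⟨?_, ?_, ?_, ?_⟩
  · apply Convex.linear_image
    apply (h.conv.prod h.conv).inter
    intro x hx y hy a b ha hb hab i
    simp [hx i, hy i]
  · apply IsCompact.image _ (LinearMap.continuous_of_finiteDimensional _)
    apply (h.comp.prod h.comp).inter_right
    simp only [ofPred_forall]
    exact isClosed_iInter fun i => isClosed_eq (by fun_prop) (by fun_prop)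
  · apply zero_interior_of_ball hr
    intro v hv
    refine ⟨(v, WithLp.toLp 2 (Fin.cons (-(v 0)) (fun i => v i.succ) : Fin (n+1) → ℝ)),
      ⟨⟨hrK hv, hrK ?_⟩, ?_⟩, ?_⟩
    · simpa [norm_reflect] using hv
    · intro i; simp
    · ext i
      refine Fin.cases ?_ (fun i => ?_) i <;> simp
  · rintro _ ⟨q, ⟨⟨h1, h2⟩, h3⟩, rfl⟩
    refine ⟨-q, ⟨⟨h.symm _ h1, h.symm _ h2⟩, ?_⟩, by simp⟩
    intro i
    simp [h3 i]

lemma SCB.symB (h : SCB K) : SCB (symB K) := by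
  obtain ⟨r, hr, hrK⟩ := h.ball
  refine ⟨?_, ?_, ?_, ?_⟩
  · apply Convex.linear_image
    apply (h.conv.prod h.conv).inter
    intro x hx y hy a b ha hb hab
    have hx : x.2 0 = - x.1 0 := hx
    have hy : y.2 0 = - y.1 0 := hy
    simp [hx, hy]; ring
  · apply IsCompact.image _ (LinearMap.continuous_of_finiteDimensional _)
    apply (h.comp.prod h.comp).inter_right
    exact isClosed_eq (by fun_prop) (by fun_prop)
  · apply zero_interior_of_ball hr
    intro v hv
    refine ⟨(v, WithLp.toLp 2 (Fin.cons (-(v 0)) (fun i => v i.succ) : Fin (n+1) → ℝ)),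
      ⟨⟨hrK hv, hrK ?_⟩, ?_⟩, ?_⟩
    · simpa [norm_reflect] using hv
    · simp
    · ext i
      refine Fin.cases ?_ (fun i => ?_) i <;> simp
  · rintro _ ⟨q, ⟨⟨h1, h2⟩, h3⟩, rfl⟩
    have h3 : q.2 0 = - q.1 0 := h3
    refine ⟨-q, ⟨⟨h.symm _ h1, h.symm _ h2⟩, ?_⟩, by simp⟩
    simp [h3]

lemma inner_split (x y : EuclideanSpace ℝ (Fin (n+1))) :
    ⟪x, y⟫ = x 0 * y 0 + ∑ i : Fin n, x i.succ * y i.succ := by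
  simp [PiLp.inner_apply, Fin.sum_univ_succ, mul_comm]

lemma symB_sub : symB (polarBody K) ⊆ polarBody (symA K) := by
  rintro _ ⟨⟨c, d⟩, ⟨⟨hc, hd⟩, h0⟩, rfl⟩ _ ⟨⟨a, b⟩, ⟨⟨ha, hb⟩, hs⟩, rfl⟩
  have h1 := hc a ha
  have h2 := hd b hb
  have h0 : d 0 = - c 0 := h0
  have hs : ∀ i : Fin n, a i.succ = b i.succ := hs
  rw [inner_split] at *
  simp only [avgMap_zero, avgMap_succ, h0] at *
  have : ∑ i : Fin n, (a i.succ + b i.succ) / 2 * ((c i.succ + d i.succ) / 2) =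
      (∑ i : Fin n, a i.succ * c i.succ + ∑ i : Fin n, b i.succ * d i.succ) / 2 := by
    rw [← Finset.sum_add_distrib, Finset.sum_div]
    apply Finset.sum_congr rfl
    intro i _
    rw [← hs i]; ring
  rw [this]
  linarith

lemma vol_symA (h : SCB K) : volume K ≤ volume (symA K) := by
  refine vol_sec_one _ _ h.comp.measurableSet h.symA.comp.measurableSet ?_
  intro a ha b hb hab v h0 hs
  refine ⟨(a, b), ⟨⟨ha, hb⟩, hab⟩, ?_⟩
  ext i
  refine Fin.cases ?_ (fun i => ?_) i
  · simp [h0]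
  · simp [hs, ← hab]

lemma vol_symB (h : SCB K) : volume K ≤ volume (symB K) := by
  refine vol_sec_two _ _ h.comp.measurableSet h.symB.comp.measurableSet ?_
  intro a ha b hb hab v h0 hs
  refine ⟨(a, -b), ⟨⟨ha, h.symm _ hb⟩, ?_⟩, ?_⟩
  · simp [hab]
  ext i
  refine Fin.cases ?_ (fun i => ?_) i
  · simp [h0, hab]
  · simp [hs, sub_eq_add_neg]

lemma steiner_eq (h : IsMx K) : polarBody (symA K) ⊆ symB (polarBody K) := by
  have hK := h.1
  refine eq_of_vol symB_sub hK.polar.symB.comp hK.symA.polar ?_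
  have h1 := h.2 _ hK.symA
  have h2 := vol_symA hK
  have h3 := vol_symB hK.polar
  have h4 : volume K * volume (polarBody (symA K)) ≤ volume K * volume (symB (polarBody K)) :=
    calc _ ≤ volume (symA K) * volume (polarBody (symA K)) := by gcongr
      _ ≤ _ := h1
      _ ≤ _ := by gcongr
  rwa [ENNReal.mul_le_mul_iff_right hK.vol_pos.ne' hK.vol_ne_top] at h4
end

end Part3

section Part4
open MeasureTheory Metric Set
open scoped RealInnerProductSpace ENNReal Pointwise

lemma const_of_slopes (α β : ℝ → ℝ) (r0 : ℝ)
    (H : ∀ r > r0, ∃ s > 0, ∀ r' > r0, s * (α r' - α r) ≤ r' - r ∧ s * (β r' - β r) ≤ r' - r)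
    (r r' : ℝ) (hr : r0 < r) (hr' : r < r') : α r - β r = α r' - β r' := by
  choose! s s0 hs using H
  set c : ℝ → ℝ := fun r => (s r)⁻¹ with hc
  have step : ∀ u v, r0 < u → u < v →
      |(α v - β v) - (α u - β u)| ≤ (c u - c v) * (v - u) := by
    intro u v hu huv
    have hv := hu.trans huv
    have a1 := (hs u hu v hv)
    have a2 := (hs v hv u hu)
    have su := s0 u hu
    have sv := s0 v hv
    have e1 : ∀ γ : ℝ, s u * γ ≤ v - u → γ ≤ c u * (v - u) := by
      intro γ h
      rw [hc, ← div_eq_inv_mul, le_div_iff₀ su]; linarith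
    have e2 : ∀ γ : ℝ, s v * γ ≤ u - v → γ ≤ c v * (u - v) := by
      intro γ h
      rw [hc, ← div_eq_inv_mul, le_div_iff₀ sv]; linarith
    have b1 := e1 _ a1.1
    have b2 := e1 _ a1.2
    have b3 := e2 _ a2.1
    have b4 := e2 _ a2.2
    rw [abs_le]
    constructor <;> nlinarith
  have key : ∀ N : ℕ, 0 < N → |(α r' - β r') - (α r - β r)| ≤ (c r - c r') * ((r' - r) / N) := by
    intro N hN
    set h := (r' - r) / N with hh
    have hN' : (0:ℝ) < N := by exact_mod_cast hN
    have h0 : 0 < h := div_pos (by linarith) hN'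
    have ind : ∀ k : ℕ, |(α (r + k * h) - β (r + k * h)) - (α r - β r)| ≤
        (c r - c (r + k * h)) * h := by
      intro k
      induction k with
      | zero => simp
      | succ k ih =>
        have st := step (r + k * h) (r + (k+1 : ℕ) * h) (by nlinarith [mul_nonneg (Nat.cast_nonneg (α := ℝ) k) h0.le]) (by push_cast; linarith)
        have e : r + (k+1 : ℕ) * h - (r + k * h) = h := by push_cast; ring
        rw [e] at st
        rw [abs_le] at *
        constructor <;> nlinarith
    have := ind N
    rwa [show r + N * h = r' by rw [hh]; field_simp; ring] at this
  have lim : Filter.Tendsto (fun N : ℕ => (c r - c r') * ((r' - r) / N)) Filter.atTop (nhds 0) := by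
    have := (tendsto_const_div_atTop_nhds_zero_nat (r' - r)).const_mul (c r - c r')
    simpa using this
  have : |(α r' - β r') - (α r - β r)| ≤ 0 :=
    ge_of_tendsto lim (Filter.eventually_atTop.2 ⟨1, fun N hN => key N hN⟩)
  have := abs_nonpos_iff.1 this
  linarith

section
variable {n : ℕ} {K : Set (EuclideanSpace ℝ (Fin (n+1)))}

lemma SCB.nhds (h : SCB K) : K ∈ nhds (0 : EuclideanSpace ℝ (Fin (n+1))) :=
  mem_interior_iff_mem_nhds.1 h.zero

lemma SCB.absorbent (h : SCB K) : Absorbent ℝ K := absorbent_nhds_zero h.nhds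

lemma SCB.g_le_one (h : SCB K) {y} : gauge K y ≤ 1 ↔ y ∈ K := by
  rw [gauge_le_one_iff_mem_closure h.conv h.nhds, h.comp.isClosed.closure_eq]

lemma SCB.g_neg (h : SCB K) (y) : gauge K (-y) = gauge K y := gauge_neg h.symm y

lemma SCB.g_smul (h : SCB K) (t : ℝ) (y) : gauge K (t • y) = |t| * gauge K y := by
  rcases le_total 0 t with ht | ht
  · rw [gauge_smul_of_nonneg ht, abs_of_nonneg ht, smul_eq_mul]
  · rw [← h.g_neg, ← neg_smul, gauge_smul_of_nonneg (by linarith : 0 ≤ -t), abs_of_nonpos ht,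
      smul_eq_mul]

lemma SCB.g_add (h : SCB K) (x y) : gauge K (x + y) ≤ gauge K x + gauge K y :=
  gauge_add_le h.conv h.absorbent x y

lemma SCB.g_cont (h : SCB K) : Continuous (gauge K) := continuous_gauge h.conv h.nhds

lemma SCB.g_le (h : SCB K) {r : ℝ} (hr : 0 < r) {y} : gauge K y ≤ r ↔ r⁻¹ • y ∈ K := by
  rw [← h.g_le_one, h.g_smul, abs_of_pos (inv_pos.2 hr), inv_mul_le_iff₀ hr, mul_one]

lemma SCB.g_norm (h : SCB K) : ∃ R > 0, ∀ y, ‖y‖ ≤ R * gauge K y := by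
  obtain ⟨R, hR, hRK⟩ := h.bdd
  refine ⟨R, hR, fun y => ?_⟩
  have := le_gauge_of_subset_closedBall h.absorbent hR.le hRK (x := y)
  rwa [div_le_iff₀ hR, mul_comm] at this

lemma SCB.g_pos (h : SCB K) {y} (hy : y ≠ 0) : 0 < gauge K y := by
  obtain ⟨R, hR, hRK⟩ := h.g_norm
  have := hRK y
  have := norm_pos_iff.2 hy
  by_contra hc
  push Not at hc
  nlinarith

lemma SCB.inner_le (h : SCB K) {c} (hc : c ∈ polarBody K) (y) : ⟪y, c⟫ ≤ gauge K y := by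
  by_cases hy : y = 0
  · simp [hy]
  have hp := h.g_pos hy
  have := hc _ ((h.g_le hp).1 le_rfl)
  rw [real_inner_smul_left, inv_mul_le_iff₀ hp, mul_one] at this
  exact this

lemma exists_support (h : SCB K) (m : EuclideanSpace ℝ (Fin (n+1))) (hm : m ∉ interior K) :
    ∃ v ∈ polarBody K, 1 ≤ ⟪m, v⟫ := by
  obtain ⟨φ, hφ⟩ := geometric_hahn_banach_open_point h.conv.interior isOpen_interior hm
  have p0 : 0 < φ m := by simpa using hφ 0 h.zero
  set w := (InnerProductSpace.toDual ℝ _).symm φ with hw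
  have hin : ∀ z, ⟪z, w⟫ = φ z := by
    intro z
    rw [real_inner_comm, hw, InnerProductSpace.toDual_symm_apply]
  refine ⟨(φ m)⁻¹ • w, ?_, ?_⟩
  · intro z hz
    have hz' : z ∈ closure (interior K) := by
      rw [h.conv.closure_interior_eq_closure_of_nonempty_interior ⟨0, h.zero⟩]
      exact subset_closure hz
    have : φ z ≤ φ m := by
      have hcl : IsClosed {z | φ z ≤ φ m} := isClosed_le (by fun_prop) (by fun_prop)
      exact (closure_minimal (fun z hz => (hφ z hz).le) hcl) hz'
    rw [real_inner_smul_right, hin, inv_mul_le_iff₀ p0, mul_one]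
    exact this
  · rw [real_inner_smul_right, hin, inv_mul_cancel₀ p0.ne']

/-- zeroth basis vector -/
noncomputable abbrev e0 (n : ℕ) : EuclideanSpace ℝ (Fin (n+1)) := EuclideanSpace.single 0 1

lemma chord_symm (h : IsMx K) (x : EuclideanSpace ℝ (Fin (n+1))) :
    ∃ μ : ℝ, ∀ t : ℝ, gauge K (x + (2 * μ - t) • e0 n) = gauge K (x + t • e0 n) := by
  have hK := h.1
  set q : ℝ → ℝ := fun t => gauge K (x + t • e0 n) with hq
  have qc : Continuous q := hK.g_cont.comp (by fun_prop)
  have qconv : ∀ r, Convex ℝ {t | q t ≤ r} := by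
    intro r s hs t ht a b ha hb hab
    have hs : q s ≤ r := hs
    have ht : q t ≤ r := ht
    change q (a • s + b • t) ≤ r
    have e : x + (a • s + b • t) • e0 n = a • (x + s • e0 n) + b • (x + t • e0 n) := by
      have : x = (a + b) • x := by rw [hab, one_smul]
      nth_rw 1 [this]
      simp only [smul_eq_mul]
      module
    calc q (a • s + b • t) ≤ a * q s + b * q t := by
          simp only [hq, e]
          refine (hK.g_add _ _).trans (le_of_eq ?_)
          rw [hK.g_smul, hK.g_smul, abs_of_nonneg ha, abs_of_nonneg hb]
      _ ≤ a * r + b * r := by gcongr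
      _ = r := by rw [← add_mul, hab, one_mul]
  have qcomp : ∀ r, IsCompact {t | q t ≤ r} := by
    intro r
    apply isCompact_of_isClosed_isBounded (isClosed_le qc continuous_const)
    obtain ⟨R, hR, hRK⟩ := hK.g_norm
    refine (isBounded_closedBall (x := (0 : ℝ)) (r := R * r + ‖x‖)).subset ?_
    intro t ht
    have ht : q t ≤ r := ht
    have h1 := hRK (x + t • e0 n)
    have h2 : ‖t • e0 n‖ ≤ ‖x + t • e0 n‖ + ‖x‖ := by
      have := norm_sub_le (x + t • e0 n) x
      simpa using this
    have h3 : ‖t • e0 n‖ = |t| := by simp [norm_smul]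
    rw [mem_closedBall_zero_iff, Real.norm_eq_abs]
    have : R * q t ≤ R * r := by gcongr
    have : ‖x + t • e0 n‖ ≤ R * q t := h1
    linarith
  obtain ⟨t0, ht0, hmin⟩ := (qcomp (q 0)).exists_isMinOn ⟨0, show q 0 ≤ q 0 from le_rfl⟩ qc.continuousOn
  have hmin : ∀ t, q t0 ≤ q t := by
    intro t
    rcases le_total (q t) (q 0) with h | h
    · exact hmin h
    · exact (show q t0 ≤ q 0 from ht0).trans h
  set r0 := q t0 with hr0
  have r0nn : 0 ≤ r0 := gauge_nonneg _
  have hA : ∀ r, r0 < r → ∃ a, IsGreatest {t | q t ≤ r} a := fun r hr =>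
    (qcomp r).exists_isGreatest ⟨t0, hr.le⟩
  have hB : ∀ r, r0 < r → ∃ a, IsLeast {t | q t ≤ r} a := fun r hr =>
    (qcomp r).exists_isLeast ⟨t0, hr.le⟩
  choose! A hA using hA
  choose! B hB using hB
  have cst := const_of_slopes A (fun r => - B r) r0 (by
    intro r hr
    have rpos : 0 < r := r0nn.trans_lt hr
    set u := r⁻¹ • (x + A r • e0 n) with hu
    set w := r⁻¹ • (x + B r • e0 n) with hw
    have uK : u ∈ K := (hK.g_le rpos).1 (hA r hr).1
    have wK : w ∈ K := (hK.g_le rpos).1 (hB r hr).1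
    have hsucc : ∀ i : Fin n, u i.succ = w i.succ := by
      intro i; simp [hu, hw]
    set m := avgMap n (u, w) with hm
    have hmint : m ∉ interior (symA K) := by
      intro hmi
      have : ∀ᶠ ε : ℝ in nhds 0, m + ε • e0 n ∈ interior (symA K) := by
        have hc : ContinuousAt (fun ε : ℝ => m + ε • e0 n) 0 := by fun_prop
        apply hc
        simp only [zero_smul, add_zero]
        exact isOpen_interior.mem_nhds hmi
      obtain ⟨ε, he, ε0⟩ := ((this.filter_mono nhdsWithin_le_nhds).and
        (self_mem_nhdsWithin (a := (0:ℝ)) (s := Ioi 0))).exists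
      have ε0 : 0 < ε := ε0
      obtain ⟨⟨u', w'⟩, ⟨⟨hu', hw'⟩, hs'⟩, heq⟩ := interior_subset he
      have hs' : ∀ i : Fin n, u' i.succ = w' i.succ := hs'
      have c0 := congrArg (fun v : EuclideanSpace ℝ (Fin (n+1)) => v 0) heq
      have cs : ∀ i : Fin n, u' i.succ = r⁻¹ * x i.succ := by
        intro i
        have := congrArg (fun v : EuclideanSpace ℝ (Fin (n+1)) => v i.succ) heq
        simp [hm, hu, hw, ← hs'] at this
        linarith
      simp [hm, hu, hw] at c0
      have e1 : u' = r⁻¹ • (x + (r * u' 0 - x 0) • e0 n) := by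
        ext i
        refine Fin.cases ?_ (fun i => ?_) i
        · simp; field_simp; ring
        · simp [cs]
      have e2 : w' = r⁻¹ • (x + (r * w' 0 - x 0) • e0 n) := by
        ext i
        refine Fin.cases ?_ (fun i => ?_) i
        · simp; field_simp; ring
        · simp [← hs', cs]
      rw [e1] at hu'
      rw [e2] at hw'
      have l1 : r * u' 0 - x 0 ≤ A r := (hA r hr).2 ((hK.g_le rpos).2 hu')
      have l2 : B r ≤ r * w' 0 - x 0 := (hB r hr).2 ((hK.g_le rpos).2 hw')
      field_simp at c0
      nlinarith [mul_pos rpos ε0]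
    obtain ⟨v, hv, hv1⟩ := exists_support hK.symA m hmint
    obtain ⟨⟨c, d⟩, ⟨⟨hc, hd⟩, hcd⟩, rfl⟩ := steiner_eq h hv
    have hcd : d 0 = - c 0 := hcd
    have ineq : ∀ t, ∀ r' ≥ q t, c 0 * t + ⟪x, c⟫ ≤ r' ∧ -(c 0 * t) + ⟪x, d⟫ ≤ r' := by
      intro t r' hr'
      have i1 := (hK.inner_le hc (x + t • e0 n)).trans hr'
      have i2 := (hK.inner_le hd (x + t • e0 n)).trans hr'
      rw [inner_add_left, real_inner_smul_left] at i1 i2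
      simp [EuclideanSpace.inner_single_left, hcd] at i1 i2
      constructor <;> linarith
    have inn : ⟪m, avgMap n (c, d)⟫ = (⟪u, c⟫ + ⟪w, d⟫) / 2 := by
      rw [inner_split, inner_split, inner_split]
      simp only [hm, avgMap_zero, avgMap_succ, hcd]
      have : ∑ i : Fin n, (u i.succ + w i.succ) / 2 * ((c i.succ + d i.succ) / 2) =
          (∑ i : Fin n, u i.succ * c i.succ + ∑ i : Fin n, w i.succ * d i.succ) / 2 := by
        rw [← Finset.sum_add_distrib, Finset.sum_div]
        apply Finset.sum_congr rfl
        intro i _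
        rw [← hsucc i]; ring
      rw [this]; ring
    have iu : ⟪u, c⟫ = r⁻¹ * (c 0 * A r + ⟪x, c⟫) := by
      rw [hu, real_inner_smul_left, inner_add_left, real_inner_smul_left]
      simp [EuclideanSpace.inner_single_left]; left; ring
    have iw : ⟪w, d⟫ = r⁻¹ * (-(c 0 * B r) + ⟪x, d⟫) := by
      rw [hw, real_inner_smul_left, inner_add_left, real_inner_smul_left]
      simp [EuclideanSpace.inner_single_left, hcd]; left; ring
    rw [inn, iu, iw] at hv1
    have k1 := (ineq (A r) r (hA r hr).1).1
    have k2 := (ineq (B r) r (hB r hr).1).2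
    have k3 : 2 * r ≤ (c 0 * A r + ⟪x, c⟫) + (-(c 0 * B r) + ⟪x, d⟫) := by
      field_simp at hv1
      linarith
    refine ⟨c 0, ?_, ?_⟩
    · have k4 := (ineq t0 r0 le_rfl).1
      have k5 : t0 ≤ A r := (hA r hr).2 hr.le
      by_contra hneg
      push Not at hneg
      nlinarith
    · intro r' hr'
      have k6 := (ineq (A r') r' (hA r' hr').1).1
      have k7 := (ineq (B r') r' (hB r' hr').1).2
      constructor <;> linarith)
  have cst' : ∀ r > r0, A r + B r = A (r0 + 1) + B (r0 + 1) := by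
    intro r hr
    rcases lt_trichotomy r (r0 + 1) with hlt | heq | hlt
    · have := cst r (r0+1) hr hlt
      linarith
    · rw [heq]
    · have := cst (r0+1) r (by linarith) hlt
      linarith
  set μ := (A (r0 + 1) + B (r0 + 1)) / 2 with hμ
  have half : ∀ t, q (2 * μ - t) ≤ q t := by
    intro t
    apply le_of_forall_gt_imp_ge_of_dense
    intro r hr
    have hr' : r0 < r := (hmin t).trans_lt hr
    have e := cst' r hr'
    have a1 : t ≤ A r := (hA r hr').2 hr.le
    have a2 : B r ≤ t := (hB r hr').2 hr.le
    have oc := (qconv r).ordConnected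
    exact oc.out (hB r hr').1 (hA r hr').1 ⟨by linarith, by linarith⟩
  refine ⟨μ, fun t => le_antisymm (half t) ?_⟩
  have := half (2 * μ - t)
  simpa using this
end

end Part4

section Part5
open MeasureTheory Metric Set
open scoped RealInnerProductSpace ENNReal Pointwise

section
variable {n : ℕ} {K : Set (EuclideanSpace ℝ (Fin (n+1)))}

lemma det_adj (A : EuclideanSpace ℝ (Fin (n+1)) →ₗ[ℝ] EuclideanSpace ℝ (Fin (n+1))) :
    LinearMap.det (LinearMap.adjoint A) = LinearMap.det A := by
  let b := EuclideanSpace.basisFun (Fin (n+1)) ℝ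
  rw [← LinearMap.det_toMatrix b.toBasis, ← LinearMap.det_toMatrix b.toBasis,
    LinearMap.toMatrix_adjoint, Matrix.det_conjTranspose]
  simp

lemma SCB.image (h : SCB K) (A : EuclideanSpace ℝ (Fin (n+1)) ≃L[ℝ] EuclideanSpace ℝ (Fin (n+1))) :
    SCB (A '' K) := by
  refine ⟨h.conv.is_linear_image A.toLinearMap.isLinear, h.comp.image A.continuous, ?_, ?_⟩
  · have := A.toHomeomorph.image_interior K
    change A '' _ = interior (A '' K) at this
    rw [← this]
    exact ⟨0, h.zero, by simp⟩
  · rintro _ ⟨x, hx, rfl⟩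
    exact ⟨-x, h.symm x hx, by simp⟩

lemma polar_image (A : EuclideanSpace ℝ (Fin (n+1)) ≃L[ℝ] EuclideanSpace ℝ (Fin (n+1))) :
    polarBody (A '' K) = (LinearMap.adjoint (A : EuclideanSpace ℝ (Fin (n+1)) →ₗ[ℝ] EuclideanSpace ℝ (Fin (n+1)))) ⁻¹' polarBody K := by
  ext y
  simp only [polarBody, mem_preimage]
  change (∀ x ∈ A '' K, ⟪x, y⟫ ≤ 1) ↔ ∀ x ∈ K, ⟪x, _⟫ ≤ 1
  simp [LinearMap.adjoint_inner_right]

lemma prod_image (A : EuclideanSpace ℝ (Fin (n+1)) ≃L[ℝ] EuclideanSpace ℝ (Fin (n+1))) :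
    volume (A '' K) * volume (polarBody (A '' K)) = volume K * volume (polarBody K) := by
  have hd : LinearMap.det (A : EuclideanSpace ℝ (Fin (n+1)) →ₗ[ℝ] EuclideanSpace ℝ (Fin (n+1))) ≠ 0 :=
    (LinearEquiv.isUnit_det' A.toLinearEquiv).ne_zero
  rw [polar_image, Measure.addHaar_preimage_linearMap _ (by rwa [det_adj]), det_adj,
    show A '' K = (A : EuclideanSpace ℝ (Fin (n+1)) →ₗ[ℝ] EuclideanSpace ℝ (Fin (n+1))) '' K from rfl,
    Measure.addHaar_image_linearMap, mul_mul_mul_comm, ← ENNReal.ofReal_mul (abs_nonneg _),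
    ← abs_mul, mul_inv_cancel₀ hd]
  simp

lemma IsMx.image (h : IsMx K) (A : EuclideanSpace ℝ (Fin (n+1)) ≃L[ℝ] EuclideanSpace ℝ (Fin (n+1))) :
    IsMx (A '' K) := ⟨h.1.image A, fun L hL => by rw [prod_image]; exact h.2 L hL⟩

lemma gauge_image (A : EuclideanSpace ℝ (Fin (n+1)) ≃L[ℝ] EuclideanSpace ℝ (Fin (n+1))) (x) :
    gauge (A '' K) (A x) = gauge K x := by
  rw [gauge_def', gauge_def']
  congr! 4 with r
  rw [← map_smul]
  exact A.injective.mem_set_image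

lemma abs_coord_le (x : EuclideanSpace ℝ (Fin (n+1))) (i) : |x i| ≤ ‖x‖ := by
  have := PiLp.norm_apply_le x i
  simpa using this

lemma exists_equiv (M : Matrix (Fin (n+1)) (Fin (n+1)) ℝ) (hM : M.det ≠ 0) :
    ∃ T : EuclideanSpace ℝ (Fin (n+1)) ≃L[ℝ] EuclideanSpace ℝ (Fin (n+1)),
      ∀ x, T x = WithLp.toLp 2 (M.mulVec x.ofLp) := by
  have hu : IsUnit M.det := hM.isUnit
  let T : EuclideanSpace ℝ (Fin (n+1)) ≃ₗ[ℝ] EuclideanSpace ℝ (Fin (n+1)) :=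
    LinearEquiv.ofLinear (Matrix.toEuclideanLin M) (Matrix.toEuclideanLin M⁻¹)
      (by ext x; simp [Matrix.toEuclideanLin_apply, Matrix.mulVec_mulVec, Matrix.mul_nonsing_inv _ hu])
      (by ext x; simp [Matrix.toEuclideanLin_apply, Matrix.mulVec_mulVec, Matrix.nonsing_inv_mul _ hu])
  exact ⟨T.toContinuousLinearEquiv, fun x => rfl⟩

lemma auerbach (h : SCB K) : ∃ A : EuclideanSpace ℝ (Fin (n+1)) ≃L[ℝ] EuclideanSpace ℝ (Fin (n+1)),
    A '' K ⊆ closedBall 0 (n+1) ∧ ∀ x, gauge (A '' K) x ≤ (n+1) * ‖x‖ := by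
  let f : (Fin (n+1) → EuclideanSpace ℝ (Fin (n+1))) → ℝ := fun v =>
    |(Matrix.of fun i j => v j i).det|
  have fc : Continuous f := by
    refine continuous_abs.comp (Continuous.matrix_det ?_)
    refine continuous_matrix fun i j => ?_
    simp only [Matrix.of_apply]
    fun_prop
  have hc : IsCompact (Set.univ.pi fun _ : Fin (n+1) => K) := isCompact_univ_pi fun _ => h.comp
  obtain ⟨v, hv, hmax⟩ := hc.exists_isMaxOn ⟨0, fun _ _ => interior_subset h.zero⟩ fc.continuousOn
  have hv' : ∀ i, v i ∈ K := by simpa using hv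
  have hpos : 0 < f v := by
    obtain ⟨r, hr, hrK⟩ := h.cball
    let w : Fin (n+1) → EuclideanSpace ℝ (Fin (n+1)) := fun j => EuclideanSpace.single j r
    have hw : w ∈ (Set.univ.pi fun _ : Fin (n+1) => K) := by
      intro i _
      apply hrK
      simp [w, abs_of_pos hr]
    refine lt_of_lt_of_le ?_ (hmax hw)
    have : (Matrix.of fun i j => w j i) = Matrix.diagonal fun _ => r := by
      ext i j
      simp [w, Matrix.diagonal_apply, Pi.single_apply]
    simp only [f, this, Matrix.det_diagonal]
    simp; positivity
  set M : Matrix (Fin (n+1)) (Fin (n+1)) ℝ := Matrix.of fun i j => v j i with hM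
  have hdet : M.det ≠ 0 := abs_pos.1 hpos
  obtain ⟨T, hT⟩ := exists_equiv M hdet
  have hTs : ∀ j, T (EuclideanSpace.single j 1) = v j := by
    intro j
    rw [hT]
    ext i
    simp [hM]
  let A := T.symm
  have hA : ∀ x ∈ K, ∀ i, |A x i| ≤ 1 := by
    intro x hx i
    have e : A x = WithLp.toLp 2 (M.det⁻¹ • M.cramer x.ofLp) := by
      change T.symm x = _
      rw [ContinuousLinearEquiv.symm_apply_eq, hT]
      simp [Matrix.mulVec_smul, Matrix.mulVec_cramer, smul_smul, hdet]
    rw [e]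
    simp only [PiLp.toLp_apply, Pi.smul_apply, Matrix.cramer_apply, smul_eq_mul, abs_mul, abs_inv]
    rw [inv_mul_le_iff₀ hpos, mul_one]
    have hw : Function.update v i x ∈ (Set.univ.pi fun _ : Fin (n+1) => K) := by
      intro j _
      by_cases hj : j = i
      · subst hj; simpa
      · simpa [hj] using hv' j
    have := hmax hw
    change f _ ≤ f v at this
    have e2 : M.updateCol i x.ofLp = Matrix.of fun a j => Function.update v i x j a := by
      ext a b
      by_cases hb : b = i
      · subst hb; simp
      · simp [hb, hM]
    rw [e2]
    exact this
  have hA1 : ∀ j, A (v j) = EuclideanSpace.single j 1 := by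
    intro j
    change T.symm _ = _
    rw [ContinuousLinearEquiv.symm_apply_eq, hTs]
  refine ⟨A, ?_, ?_⟩
  · rintro _ ⟨x, hx, rfl⟩
    rw [mem_closedBall_zero_iff, EuclideanSpace.norm_eq]
    apply Real.sqrt_le_iff.2 ⟨by positivity, ?_⟩
    calc ∑ i, ‖A x i‖ ^ 2 ≤ ∑ i : Fin (n+1), 1 := by
          gcongr with i
          have := hA x hx i
          rw [Real.norm_eq_abs]
          nlinarith [abs_nonneg (A x i)]
      _ ≤ _ := by simp; nlinarith
  · intro x
    have hx : x = ∑ i, x i • EuclideanSpace.single i (1:ℝ) := by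
      ext j
      simp [Pi.single_apply]
    calc gauge (A '' K) x = gauge (A '' K) (∑ i, x i • EuclideanSpace.single i (1:ℝ)) := by rw [← hx]
      _ ≤ ∑ i, gauge (A '' K) (x i • EuclideanSpace.single i (1:ℝ)) :=
        gauge_sum_le (h.image A).conv (h.image A).absorbent _ _
      _ ≤ ∑ i : Fin (n+1), ‖x‖ := by
        gcongr with i
        rw [(h.image A).g_smul, ← hA1, gauge_image]
        have := abs_coord_le x i
        have := h.g_le_one.2 (hv' i)
        nlinarith [abs_nonneg (x i), norm_nonneg x]
      _ = _ := by simp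
end

end Part5

section Part6
open MeasureTheory Metric Set
open scoped RealInnerProductSpace ENNReal Pointwise

section
variable {n : ℕ} {K : Set (EuclideanSpace ℝ (Fin (n+1)))}

lemma seq_limit (p : ℕ → EuclideanSpace ℝ (Fin (n+1)) → ℝ) (C : ℝ) (hC : 0 < C)
    (h0 : ∀ j x, 0 ≤ p j x) (h1 : ∀ j x, p j x ≤ C * ‖x‖)
    (h2 : ∀ j x y, |p j x - p j y| ≤ C * ‖x - y‖) :
    ∃ φ : ℕ → ℕ, StrictMono φ ∧ ∀ x, ∃ l, Filter.Tendsto (fun j => p (φ j) x) Filter.atTop (nhds l) := by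
  let d := TopologicalSpace.denseSeq (EuclideanSpace ℝ (Fin (n+1)))
  have hd : DenseRange d := TopologicalSpace.denseRange_denseSeq _
  have hc : IsCompact (Set.univ.pi fun k : ℕ => Icc (0:ℝ) (C * ‖d k‖)) :=
    isCompact_univ_pi fun _ => isCompact_Icc
  obtain ⟨a, -, φ, hφ, ha⟩ := hc.tendsto_subseq (x := fun j k => p j (d k))
    (fun j k _ => ⟨h0 _ _, h1 _ _⟩)
  refine ⟨φ, hφ, fun x => ?_⟩
  apply cauchySeq_tendsto_of_complete
  rw [Metric.cauchySeq_iff']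
  intro ε hε
  obtain ⟨k, hk⟩ := hd.exists_dist_lt x (ε := ε / (4 * C)) (by positivity)
  have hcs := ((tendsto_pi_nhds.1 ha k).cauchySeq)
  obtain ⟨N, hN⟩ := (Metric.cauchySeq_iff'.1 hcs) (ε/2) (by positivity)
  refine ⟨N, fun m hm => ?_⟩
  have e1 := hN m hm
  have e2 := h2 (φ m) x (d k)
  have e3 := h2 (φ N) x (d k)
  rw [dist_eq_norm, lt_div_iff₀ (by positivity)] at hk
  simp only [Real.dist_eq, Function.comp] at e1 ⊢
  rw [abs_lt] at *
  rw [abs_le] at *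
  constructor <;> nlinarith

lemma lim_sets {X : Type*} [MeasurableSpace X] (μ : Measure X) (s : ℕ → Set X) (W T : Set X)
    (hs : ∀ j, MeasurableSet (s j))
    (hW : ∀ j, s j ⊆ W) (hWf : μ W ≠ ∞) (S : ℝ≥0∞)
    (hT : ∀ x, (∃ᶠ j in Filter.atTop, x ∈ s j) → x ∈ T)
    (hS : Filter.Tendsto (fun j => μ (s j)) Filter.atTop (nhds S)) : S ≤ μ T := by
  let u : ℕ → Set X := fun j => ⋃ i ≥ j, s i
  have hu : ∀ j, MeasurableSet (u j) := fun j => MeasurableSet.iUnion fun i => MeasurableSet.iUnion fun _ => hs i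
  have hl : Filter.Tendsto (fun j => μ (u j)) Filter.atTop (nhds (μ (⋂ j, u j))) := by
    refine tendsto_measure_iInter_atTop (fun j => (hu j).nullMeasurableSet) ?_ ⟨0, ?_⟩
    · intro a b hab x hx
      simp only [u, mem_iUnion] at hx ⊢
      obtain ⟨i, hi, hx⟩ := hx
      exact ⟨i, hab.trans hi, hx⟩
    · exact measure_ne_top_of_subset (iUnion₂_subset fun i _ => hW i) hWf
  have h1 : S ≤ μ (⋂ j, u j) := le_of_tendsto_of_tendsto' hS hl fun j =>
    measure_mono (subset_biUnion_of_mem (u := s) (le_refl j))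
  refine h1.trans (measure_mono fun x hx => hT x ?_)
  rw [Filter.frequently_atTop]
  intro a
  have := mem_iInter.1 hx a
  simp only [u, mem_iUnion] at this
  obtain ⟨i, hi, hx⟩ := this
  exact ⟨i, hi, hx⟩

lemma SCB_ball : SCB (closedBall (0 : EuclideanSpace ℝ (Fin (n+1))) 1) :=
  ⟨convex_closedBall _ _, isCompact_closedBall _ _, zero_interior_of_ball one_pos ball_subset_closedBall,
    fun x hx => by simpa using hx⟩

lemma exists_max (n : ℕ) : ∃ K : Set (EuclideanSpace ℝ (Fin (n+1))), IsMx K := by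
  let P : Set (EuclideanSpace ℝ (Fin (n+1))) → ℝ≥0∞ := fun K => volume K * volume (polarBody K)
  obtain ⟨u, -, hu, hu'⟩ := exists_seq_tendsto_sSup (S := P '' {K | SCB K})
    ⟨_, mem_image_of_mem P (show SCB _ from SCB_ball)⟩ (OrderTop.bddAbove _)
  set S := sSup (P '' {K | SCB K}) with hS
  have : ∀ j, ∃ K, SCB K ∧ P K = u j ∧ K ⊆ closedBall 0 (n+1) ∧ ∀ x, gauge K x ≤ (n+1) * ‖x‖ := by
    intro j
    obtain ⟨K, hK, hj⟩ := hu' j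
    have hK : SCB K := hK
    obtain ⟨A, h1, h2⟩ := auerbach hK
    exact ⟨A '' K, hK.image A, (prod_image A).trans hj, h1, h2⟩
  choose L hL hP hL1 hL2 using this
  have npos : (0:ℝ) < n + 1 := by positivity
  obtain ⟨φ, hφ, hl⟩ := seq_limit (fun j => gauge (L j)) (n+1) npos (fun j x => gauge_nonneg x) hL2
    (by
      intro j x y
      have e1 := (hL j).g_add (x - y) y
      have e2 := (hL j).g_add (y - x) x
      have e3 := hL2 j (x - y)
      have e4 := hL2 j (y - x)
      rw [sub_add_cancel] at e1 e2
      rw [norm_sub_rev] at e4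
      rw [abs_le]; constructor <;> linarith)
  choose p hp using hl
  have padd : ∀ x y, p (x + y) ≤ p x + p y := fun x y =>
    le_of_tendsto_of_tendsto' (hp _) ((hp x).add (hp y)) fun j => (hL _).g_add x y
  have psmul : ∀ (t : ℝ) x, p (t • x) = |t| * p x := fun t x =>
    tendsto_nhds_unique (hp _) (((hp x).const_mul |t|).congr fun j => ((hL _).g_smul t x).symm)
  have pup : ∀ x, p x ≤ (n+1) * ‖x‖ := fun x => le_of_tendsto' (hp x) fun j => hL2 _ x
  have plo : ∀ x, ‖x‖ ≤ (n+1) * p x := fun x => ge_of_tendsto' ((hp x).const_mul (n+1:ℝ)) fun j => by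
    have := le_gauge_of_subset_closedBall (hL (φ j)).absorbent npos.le (hL1 (φ j)) (x := x)
    rw [div_le_iff₀ npos] at this
    linarith
  have pcont : Continuous p := by
    refine LipschitzWith.continuous (K := ⟨n+1, npos.le⟩) (LipschitzWith.of_dist_le_mul ?_)
    intro x y
    have e1 := padd (x - y) y
    have e2 := padd (y - x) x
    have e3 := pup (x - y)
    have e4 := pup (y - x)
    rw [sub_add_cancel] at e1 e2
    rw [norm_sub_rev] at e4
    rw [Real.dist_eq, dist_eq_norm, abs_le]; 
    change -((n+1:ℝ) * _) ≤ _ ∧ _ ≤ (n+1 : ℝ) * _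
    constructor <;> linarith
  have hK : SCB {x | p x ≤ 1} := by
    refine ⟨?_, ?_, ?_, ?_⟩
    · intro x hx y hy a b ha hb hab
      have hx : p x ≤ 1 := hx
      have hy : p y ≤ 1 := hy
      change p _ ≤ 1
      have := padd (a • x) (b • y)
      rw [psmul, psmul, abs_of_nonneg ha, abs_of_nonneg hb] at this
      nlinarith
    · refine Metric.isCompact_of_isClosed_isBounded (isClosed_le pcont continuous_const) ?_
      refine (isBounded_closedBall (x := (0 : EuclideanSpace ℝ (Fin (n+1)))) (r := n+1)).subset fun x hx => ?_
      have hx : p x ≤ 1 := hx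
      rw [mem_closedBall_zero_iff]
      nlinarith [plo x]
    · refine zero_interior_of_ball (r := 1 / (n+1)) (by positivity) fun x hx => ?_
      rw [mem_ball_zero_iff, lt_div_iff₀ npos] at hx
      change p x ≤ 1
      linarith [pup x]
    · intro x hx
      have hx : p x ≤ 1 := hx
      change p (-x) ≤ 1
      have := psmul (-1) x
      simp at this
      rwa [this]
  refine ⟨_, hK, fun M hM => ?_⟩
  have hMS : P M ≤ S := le_sSup ⟨M, hM, rfl⟩
  refine hMS.trans ?_
  rw [← Measure.prod_prod]
  have bddp : ∀ j, polarBody (L j) ⊆ closedBall 0 (n+1) := by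
    intro j y hy
    rw [mem_closedBall_zero_iff]
    have := ((hL j).inner_le hy y).trans (hL2 j y)
    rw [real_inner_self_eq_norm_sq] at this
    by_contra hcon
    push Not at hcon
    nlinarith [norm_nonneg y]
  refine lim_sets (volume.prod volume) (fun j => L (φ j) ×ˢ polarBody (L (φ j)))
    (closedBall 0 (n+1) ×ˢ closedBall 0 (n+1)) _
    (fun j => (hL _).comp.measurableSet.prod (hL _).polar.comp.measurableSet)
    (fun j => prod_mono (hL1 _) (bddp _)) ?_ _ ?_ ?_
  · rw [Measure.prod_prod]
    exact ENNReal.mul_ne_top measure_closedBall_lt_top.ne measure_closedBall_lt_top.ne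
  · rintro ⟨x, y⟩ hxy
    refine ⟨?_, ?_⟩
    · change p x ≤ 1
      by_contra hcon
      push Not at hcon
      refine hxy (((hp x).eventually (lt_mem_nhds hcon)).mono fun j hj hm => ?_)
      have := (hL _).g_le_one.2 hm.1
      linarith
    · intro z hz
      have hz : p z ≤ 1 := hz
      refine le_trans ?_ hz
      by_contra hcon
      push Not at hcon
      refine hxy (((hp z).eventually (gt_mem_nhds hcon)).mono fun j hj hm => ?_)
      have := (hL _).inner_le hm.2 z
      linarith
  · simp only [Measure.prod_prod]
    refine (hu.comp hφ.tendsto_atTop).congr fun j => ?_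
    exact (hP _).symm
end

end Part6

section Part7
open MeasureTheory Metric Set
open scoped RealInnerProductSpace ENNReal Pointwise

section
variable {n : ℕ} {K : Set (EuclideanSpace ℝ (Fin (n+1)))}

lemma chord_symm' (h : IsMx K) (e : EuclideanSpace ℝ (Fin (n+1))) (he : e ≠ 0) (x : EuclideanSpace ℝ (Fin (n+1))) :
    ∃ μ : ℝ, ∀ t : ℝ, gauge K (x + (2 * μ - t) • e) = gauge K (x + t • e) := by
  obtain ⟨A, hA⟩ := SeparatingDual.exists_continuousLinearEquiv_apply_eq (R := ℝ) he
    (show e0 n ≠ 0 by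
      intro h
      have := congrArg (fun v : EuclideanSpace ℝ (Fin (n+1)) => v 0) h
      simp [e0] at this)
  obtain ⟨μ, hμ⟩ := chord_symm (h.image A) (A x)
  refine ⟨μ, fun t => ?_⟩
  have := hμ t
  rwa [← hA, ← map_smul, ← map_smul, ← map_add, ← map_add, gauge_image, gauge_image] at this

lemma asym (h : SCB K) {e : EuclideanSpace ℝ (Fin (n+1))} {l : EuclideanSpace ℝ (Fin (n+1)) →L[ℝ] ℝ}
    (hl : HasFDerivAt (gauge K) l e) (x : EuclideanSpace ℝ (Fin (n+1))) :
    Filter.Tendsto (fun t : ℝ => gauge K (x + t • e) - t * gauge K e) Filter.atTop (nhds (l x)) := by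
  have := hl.lim (v := x) (c := fun t : ℝ => t) (l := Filter.atTop) Filter.tendsto_abs_atTop_atTop
  refine this.congr' ?_
  filter_upwards [Filter.eventually_gt_atTop 0] with t ht
  have e1 : x + t • e = t • (e + t⁻¹ • x) := by
    rw [smul_add, smul_smul, mul_inv_cancel₀ ht.ne', one_smul, add_comm x]
  rw [e1, h.g_smul, abs_of_pos ht, smul_eq_mul, mul_sub]

lemma refl_inv (h : IsMx K) {e : EuclideanSpace ℝ (Fin (n+1))} (he : e ≠ 0)
    {l : EuclideanSpace ℝ (Fin (n+1)) →L[ℝ] ℝ}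
    (hl : HasFDerivAt (gauge K) l e) (x : EuclideanSpace ℝ (Fin (n+1))) :
    gauge K (x - (2 * (l x / gauge K e)) • e) = gauge K x := by
  obtain ⟨μ, hμ⟩ := chord_symm' h e he x
  have hp := h.1.g_pos he
  have a1 := asym h.1 hl x
  have a2 := asym h.1 hl (-x)
  have a3 : Filter.Tendsto (fun t : ℝ => gauge K (-x + (t - 2 * μ) • e) - (t - 2 * μ) * gauge K e)
      Filter.atTop (nhds (l (-x))) :=
    a2.comp (Filter.tendsto_atTop_add_const_right _ (-(2 * μ)) Filter.tendsto_id)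
  have a4 := (a1.sub a3)
  have a5 : ∀ t : ℝ, gauge K (x + t • e) - t * gauge K e - (gauge K (-x + (t - 2 * μ) • e) - (t - 2 * μ) * gauge K e)
      = - (2 * μ * gauge K e) := by
    intro t
    have : gauge K (-x + (t - 2 * μ) • e) = gauge K (x + t • e) := by
      rw [← hμ t, ← h.1.g_neg]
      congr 1
      module
    rw [this]; ring
  have a6 := tendsto_nhds_unique a4 (by simp only [a5]; exact tendsto_const_nhds)
  rw [map_neg] at a6
  have a7 : l x / gauge K e = - μ := by
    field_simp
    linarith
  have := hμ 0
  rw [a7]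
  convert this using 2
  · module
  · module

lemma refl_at (h : SCB K) {e : EuclideanSpace ℝ (Fin (n+1))}
    {l : EuclideanSpace ℝ (Fin (n+1)) →L[ℝ] ℝ}
    (hl : HasFDerivAt (gauge K) l e) : l e = gauge K e := by
  have a1 := asym h hl e
  refine tendsto_nhds_unique a1 (tendsto_const_nhds.congr' ?_)
  filter_upwards [Filter.eventually_gt_atTop 0] with t ht
  have e1 : e + t • e = (1 + t) • e := by module
  rw [e1, h.g_smul, abs_of_pos (by linarith)]
  ring

lemma dense_diff (h : SCB K) : Dense {e | DifferentiableAt ℝ (gauge K) e} := by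
  obtain ⟨r, hr, hrK⟩ := h.ball
  have hL : LipschitzWith (⟨r, hr.le⟩ : NNReal)⁻¹ (gauge K) :=
    h.conv.lipschitzWith_gauge (r := ⟨r, hr.le⟩) hr hrK
  exact Measure.dense_of_ae (μ := volume) hL.ae_differentiableAt
end

end Part7

section Part8
open MeasureTheory Metric Set
open scoped RealInnerProductSpace ENNReal Pointwise

section
variable {n : ℕ} {K : Set (EuclideanSpace ℝ (Fin (n+1)))}

lemma int_on (h : SCB K) {f : EuclideanSpace ℝ (Fin (n+1)) → ℝ} (hf : Continuous f) :
    IntegrableOn f K := hf.continuousOn.integrableOn_compact h.comp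

open scoped MatrixOrder Matrix in
lemma sqrt_mat (C : Matrix (Fin (n+1)) (Fin (n+1)) ℝ) (hC : C.PosDef) :
    ∃ M : Matrix (Fin (n+1)) (Fin (n+1)) ℝ, Mᵀ = M ∧ M * M = C ∧ M.det ≠ 0 := by
  refine ⟨CFC.sqrt C, ?_, CFC.sqrt_mul_sqrt_self C hC.posSemidef.nonneg, ?_⟩
  · have := (Matrix.nonneg_iff_posSemidef.1 (CFC.sqrt_nonneg C)).isHermitian
    simpa [Matrix.IsHermitian, Matrix.conjTranspose_eq_transpose_of_trivial] using this
  · have h1 : (CFC.sqrt C * CFC.sqrt C).det ≠ 0 := by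
      rw [CFC.sqrt_mul_sqrt_self C hC.posSemidef.nonneg]
      exact hC.det_pos.ne'
    rw [Matrix.det_mul] at h1
    exact left_ne_zero_of_mul h1

lemma cov (h : SCB K) : ∃ T : EuclideanSpace ℝ (Fin (n+1)) ≃L[ℝ] EuclideanSpace ℝ (Fin (n+1)),
    (∀ x y, ⟪T x, y⟫ = ⟪x, T y⟫) ∧ ∀ u, ∫ x in K, ⟪x, u⟫ ^ 2 = ‖T u‖ ^ 2 := by
  let C : Matrix (Fin (n+1)) (Fin (n+1)) ℝ := Matrix.of fun i j => ∫ x in K, x i * x j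
  have hin : ∀ i j : Fin (n+1), IntegrableOn (fun x : EuclideanSpace ℝ (Fin (n+1)) => x i * x j) K :=
    fun i j => int_on h (by fun_prop)
  have hq : ∀ u : EuclideanSpace ℝ (Fin (n+1)), ∫ x in K, ⟪x, u⟫ ^ 2 = u.ofLp ⬝ᵥ (C.mulVec u.ofLp) := by
    intro u
    have e : ∀ x : EuclideanSpace ℝ (Fin (n+1)), ⟪x, u⟫ ^ 2 = ∑ i, ∑ j, u i * u j * (x i * x j) := by
      intro x
      rw [PiLp.inner_apply, sq, Finset.sum_mul_sum]
      simp
      refine Finset.sum_congr rfl fun i _ => Finset.sum_congr rfl fun j _ => ?_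
      ring
    simp only [e]
    rw [integral_finsetSum _ fun i _ => integrable_finsetSum _ fun j _ => (hin i j).const_mul _]
    simp only [dotProduct, Matrix.mulVec, Finset.mul_sum]
    refine Finset.sum_congr rfl fun i _ => ?_
    rw [integral_finsetSum _ fun j _ => (hin i j).const_mul _]
    refine Finset.sum_congr rfl fun j _ => ?_
    rw [integral_const_mul]
    simp only [C, Matrix.of_apply]
    ring
  have hC : C.PosDef := by
    rw [Matrix.posDef_iff_dotProduct_mulVec]
    refine ⟨?_, ?_⟩
    · ext i j
      simp [C, mul_comm]
    · intro u hu
      have hu' : (WithLp.toLp 2 u : EuclideanSpace ℝ (Fin (n+1))) ≠ 0 := by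
        intro h0
        apply hu
        simpa using h0
      have := hq (WithLp.toLp 2 u)
      simp only [star_trivial]
      change _ = u ⬝ᵥ (C.mulVec u) at this
      rw [← this]
      rw [setIntegral_pos_iff_support_of_nonneg_ae (Filter.Eventually.of_forall fun x => sq_nonneg _)
        (int_on h (by fun_prop))]
      obtain ⟨r, hr, hrK⟩ := h.ball
      have hop : IsOpen (Function.support (fun x : EuclideanSpace ℝ (Fin (n+1)) =>
          ⟪x, (WithLp.toLp 2 u : EuclideanSpace ℝ (Fin (n+1)))⟫ ^ 2) ∩ ball 0 r) :=
        (isOpen_ne.preimage (by fun_prop : Continuous fun x : EuclideanSpace ℝ (Fin (n+1)) =>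
          ⟪x, (WithLp.toLp 2 u : EuclideanSpace ℝ (Fin (n+1)))⟫ ^ 2)).inter isOpen_ball
      refine (hop.measure_pos volume ?_).trans_le (measure_mono (inter_subset_inter_right _ hrK))
      set w : EuclideanSpace ℝ (Fin (n+1)) := WithLp.toLp 2 u with hw
      have hw0 := norm_pos_iff.2 hu'
      refine ⟨(r / (2 * ‖w‖)) • w, ?_, ?_⟩
      · rw [Function.mem_support, real_inner_smul_left, real_inner_self_eq_norm_sq]
        positivity
      · rw [mem_ball_zero_iff, norm_smul, Real.norm_eq_abs, abs_of_pos (by positivity)]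
        field_simp
        linarith
  obtain ⟨M, hMt, hMM, hMd⟩ := sqrt_mat C hC
  obtain ⟨T, hT⟩ := exists_equiv M hMd
  have hsym : ∀ x y, ⟪T x, y⟫ = ⟪x, T y⟫ := by
    intro x y
    rw [hT, hT]
    simp only [EuclideanSpace.inner_eq_star_dotProduct, star_trivial]
    rw [Matrix.dotProduct_mulVec, ← Matrix.mulVec_transpose, hMt]
  refine ⟨T, hsym, fun u => ?_⟩
  rw [hq, ← real_inner_self_eq_norm_sq, hsym, hT, hT, ← hMM]
  simp only [EuclideanSpace.inner_eq_star_dotProduct, star_trivial, ← Matrix.mulVec_mulVec]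
  rw [dotProduct_comm]

lemma int_image (hK : MeasurableSet K) (A : EuclideanSpace ℝ (Fin (n+1)) ≃L[ℝ] EuclideanSpace ℝ (Fin (n+1)))
    (f : EuclideanSpace ℝ (Fin (n+1)) → ℝ) :
    ∫ x in A '' K, f x = |(A : EuclideanSpace ℝ (Fin (n+1)) →L[ℝ] EuclideanSpace ℝ (Fin (n+1))).det| *
      ∫ x in K, f (A x) := by
  rw [integral_image_eq_integral_abs_det_fderiv_smul volume hK
    (fun x _ => A.hasFDerivAt.hasFDerivWithinAt) A.injective.injOn f]
  simp only [smul_eq_mul]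
  rw [integral_const_mul]

lemma iso_pos (h : IsMx K) : ∃ A : EuclideanSpace ℝ (Fin (n+1)) ≃L[ℝ] EuclideanSpace ℝ (Fin (n+1)),
    ∃ c : ℝ, 0 < c ∧ ∀ u, ∫ x in A '' K, ⟪x, u⟫ ^ 2 = c * ‖u‖ ^ 2 := by
  obtain ⟨T, hs, hT⟩ := cov h.1
  refine ⟨T.symm, |(T.symm : EuclideanSpace ℝ (Fin (n+1)) →L[ℝ] EuclideanSpace ℝ (Fin (n+1))).det|, ?_, fun u => ?_⟩
  rotate_left
  · rw [int_image h.1.comp.measurableSet]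
    congr 1
    have : ∀ x, ⟪T.symm x, u⟫ = ⟪x, T.symm u⟫ := by
      intro x
      have := hs (T.symm x) (T.symm u)
      simpa using this.symm
    simp only [this, hT]
    simp
  · rw [abs_pos]
    exact (LinearEquiv.isUnit_det' T.symm.toLinearEquiv).ne_zero

lemma refl_iso (h : SCB K) {c : ℝ} (hc : 0 < c) (hiso : ∀ u, ∫ x in K, ⟪x, u⟫ ^ 2 = c * ‖u‖ ^ 2)
    (e a : EuclideanSpace ℝ (Fin (n+1))) (hae : ⟪a, e⟫ = 1)
    (hS : ∀ x, gauge K (x - (2 * ⟪a, x⟫) • e) = gauge K x) : a = (‖e‖ ^ 2)⁻¹ • e := by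
  let S₀ : EuclideanSpace ℝ (Fin (n+1)) →ₗ[ℝ] EuclideanSpace ℝ (Fin (n+1)) :=
    { toFun := fun x => x - (2 * ⟪a, x⟫) • e
      map_add' := fun x y => by rw [inner_add_right]; module
      map_smul' := fun t x => by rw [real_inner_smul_right]; simp only [RingHom.id_apply]; module }
  have hS0 : ∀ x, S₀ x = x - (2 * ⟪a, x⟫) • e := fun x => rfl
  have hinv : Function.Involutive S₀ := by
    intro x
    simp only [hS0, inner_sub_right, real_inner_smul_right, hae]
    module
  let S : EuclideanSpace ℝ (Fin (n+1)) ≃L[ℝ] EuclideanSpace ℝ (Fin (n+1)) :=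
    (LinearEquiv.ofInvolutive S₀ hinv).toContinuousLinearEquiv
  have hSx : ∀ x, S x = x - (2 * ⟪a, x⟫) • e := fun x => rfl
  have hSK : S '' K = K := by
    have hsub : ∀ x ∈ K, S x ∈ K := by
      intro x hx
      rw [← h.g_le_one, hSx, hS]
      exact h.g_le_one.2 hx
    refine Subset.antisymm (by rintro _ ⟨x, hx, rfl⟩; exact hsub x hx) fun x hx => ⟨S x, hsub x hx, hinv x⟩
  have hdet : |(S : EuclideanSpace ℝ (Fin (n+1)) →L[ℝ] EuclideanSpace ℝ (Fin (n+1))).det| = 1 := by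
    change |LinearMap.det S₀| = 1
    have h1 : LinearMap.det (S₀ ∘ₗ S₀) = 1 := by
      have : S₀ ∘ₗ S₀ = LinearMap.id := LinearMap.ext hinv
      rw [this, LinearMap.det_id]
    rw [LinearMap.det_comp] at h1
    have h2 : |LinearMap.det S₀| * |LinearMap.det S₀| = 1 := by rw [← abs_mul, h1, abs_one]
    nlinarith [abs_nonneg (LinearMap.det S₀)]
  have key : ∀ u, ‖u - (2 * ⟪e, u⟫) • a‖ ^ 2 = ‖u‖ ^ 2 := by
    intro u
    have h1 := int_image h.comp.measurableSet S fun x => ⟪x, u⟫ ^ 2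
    rw [hSK, hdet, one_mul, hiso] at h1
    have h2 : ∀ x, ⟪S x, u⟫ = ⟪x, u - (2 * ⟪e, u⟫) • a⟫ := by
      intro x
      rw [hSx, inner_sub_left, inner_sub_right, real_inner_smul_left, real_inner_smul_right,
        real_inner_comm a x]
      ring
    simp only [h2] at h1
    rw [hiso] at h1
    exact (mul_left_cancel₀ hc.ne' h1).symm
  have he : e ≠ 0 := by rintro rfl; simp at hae
  have hen := norm_pos_iff.2 he
  have k := key e
  rw [norm_sub_sq_real, real_inner_smul_right, norm_smul, real_inner_self_eq_norm_sq,
    real_inner_comm, hae, mul_pow, Real.norm_eq_abs, sq_abs] at k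
  have k2 : ‖a‖ ^ 2 * ‖e‖ ^ 2 = 1 := by
    have : ‖e‖ ^ 2 * (‖a‖ ^ 2 * ‖e‖ ^ 2 - 1) = 0 := by nlinarith
    rcases mul_eq_zero.1 this with h | h
    · exact absurd h (by positivity)
    · linarith
  rw [← sub_eq_zero, ← norm_eq_zero, ← sq_eq_zero_iff, norm_sub_sq_real, real_inner_smul_right, hae, norm_smul,
    mul_pow, Real.norm_eq_abs, sq_abs]
  field_simp
  linarith

lemma iso_ball (h : IsMx K) {c : ℝ} (hc : 0 < c) (hiso : ∀ u, ∫ x in K, ⟪x, u⟫ ^ 2 = c * ‖u‖ ^ 2) :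
    ∃ r > 0, K = closedBall 0 r := by
  have hK := h.1
  have h1 : ∀ x e : EuclideanSpace ℝ (Fin (n+1)),
      gauge K (‖e‖ ^ 2 • x - (2 * ⟪e, x⟫) • e) = ‖e‖ ^ 2 * gauge K x := by
    intro x
    have := Continuous.ext_on (dense_diff hK)
      (f := fun e => gauge K (‖e‖ ^ 2 • x - (2 * ⟪e, x⟫) • e)) (g := fun e => ‖e‖ ^ 2 * gauge K x)
      (hK.g_cont.comp (by fun_prop)) (by fun_prop) ?_
    · exact fun e => congrFun this e
    · intro e he
      have he : DifferentiableAt ℝ (gauge K) e := he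
      by_cases e0 : e = 0
      · simp [e0]
      have hd := he.hasFDerivAt
      set l := fderiv ℝ (gauge K) e with hl
      have hp := hK.g_pos e0
      let a := (gauge K e)⁻¹ • (InnerProductSpace.toDual ℝ _).symm l
      have ha : ∀ x, ⟪a, x⟫ = l x / gauge K e := by
        intro x
        simp only [a, real_inner_smul_left, InnerProductSpace.toDual_symm_apply]
        ring
      have hr := refl_iso hK hc hiso e a (by rw [ha, refl_at hK hd, div_self hp.ne'])
        (fun x => by rw [ha]; exact refl_inv h e0 hd x)
      have h2 := refl_inv h e0 hd x
      rw [← ha, hr, real_inner_smul_left] at h2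
      have hen := norm_pos_iff.2 e0
      rw [← h2]
      have hgs := hK.g_smul (‖e‖ ^ 2) (x - (2 * ((‖e‖ ^ 2)⁻¹ * ⟪e, x⟫)) • e)
      rw [abs_of_pos (by positivity : 0 < ‖e‖ ^ 2)] at hgs
      change gauge K _ = _ * gauge K _
      rw [← hgs]
      congr 1
      rw [smul_sub, smul_smul]
      congr 2
      field_simp
  have h2 : ∀ x y : EuclideanSpace ℝ (Fin (n+1)), ‖x‖ = ‖y‖ → gauge K x = gauge K y := by
    intro x y hxy
    by_cases hne : x = y
    · rw [hne]
    have := h1 x (x - y)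
    have hp : 0 < ‖x - y‖ ^ 2 := by
      have := norm_pos_iff.2 (sub_ne_zero.2 hne)
      positivity
    have e1 : 2 * ⟪x - y, x⟫ = ‖x - y‖ ^ 2 := by
      rw [norm_sub_sq_real, inner_sub_left, real_inner_self_eq_norm_sq, real_inner_comm x y, hxy]
      ring
    rw [e1, ← smul_sub, hK.g_smul, abs_of_pos hp, sub_sub_cancel] at this
    exact (mul_left_cancel₀ hp.ne' this).symm
  have hp : 0 < gauge K (e0 n) := hK.g_pos (by
      intro h
      have := congrArg (fun v : EuclideanSpace ℝ (Fin (n+1)) => v 0) h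
      simp [e0] at this)
  have h3 : ∀ x, gauge K x = ‖x‖ * gauge K (e0 n) := by
    intro x
    rw [h2 x (‖x‖ • e0 n) (by simp [e0, norm_smul]), hK.g_smul, abs_norm]
  refine ⟨(gauge K (e0 n))⁻¹, inv_pos.2 hp, ?_⟩
  ext x
  rw [← hK.g_le_one, h3, mem_closedBall_zero_iff, ← le_div_iff₀ hp, inv_eq_one_div]

lemma mx_ellipsoid (h : IsMx K) : ∃ A : EuclideanSpace ℝ (Fin (n+1)) ≃L[ℝ] EuclideanSpace ℝ (Fin (n+1)),
    K = A '' closedBall 0 1 := by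
  obtain ⟨A, c, hc, hiso⟩ := iso_pos h
  obtain ⟨r, hr, hK⟩ := iso_ball (h.image A) hc hiso
  let D : EuclideanSpace ℝ (Fin (n+1)) ≃L[ℝ] EuclideanSpace ℝ (Fin (n+1)) :=
    (LinearEquiv.smulOfNeZero ℝ _ r hr.ne').toContinuousLinearEquiv
  have hD : D '' closedBall 0 1 = closedBall 0 r := by
    have := smul_closedBall' hr.ne' (0 : EuclideanSpace ℝ (Fin (n+1))) 1
    rw [smul_zero, mul_one, Real.norm_eq_abs, abs_of_pos hr] at this
    rw [← this]; rfl
  refine ⟨D.trans A.symm, ?_⟩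
  have : K = A.symm '' (A '' K) := by
    rw [← image_comp]; simp
  rw [this, hK, ← hD, ← image_comp]
  rfl

lemma polar_ball : polarBody (closedBall (0 : EuclideanSpace ℝ (Fin (n+1))) 1) = closedBall 0 1 := by
  ext y
  rw [mem_closedBall_zero_iff]
  constructor
  · intro hy
    by_contra hcon
    push Not at hcon
    have := hy (‖y‖⁻¹ • y) (by
      rw [mem_closedBall_zero_iff, norm_smul, norm_inv, norm_norm, inv_mul_cancel₀ (by linarith)])
    rw [real_inner_smul_left, real_inner_self_eq_norm_sq, sq, ← mul_assoc, inv_mul_cancel₀ (by linarith)] at this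
    linarith
  · intro hy x hx
    rw [mem_closedBall_zero_iff] at hx
    have := real_inner_le_norm x y
    nlinarith [norm_nonneg x, norm_nonneg y]

lemma main_aux (K : Set (EuclideanSpace ℝ (Fin (n + 1))))
    (hconv : Convex ℝ K) (hcomp : IsCompact K) (hint : (interior K).Nonempty)
    (hsymm : K = -K)
    (heq : volume K * volume (polarBody K) =
      (volume (closedBall (0 : EuclideanSpace ℝ (Fin (n + 1))) 1)) ^ 2) :
    ∃ A : EuclideanSpace ℝ (Fin (n + 1)) ≃ₗ[ℝ] EuclideanSpace ℝ (Fin (n + 1)),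
      K = A '' closedBall (0 : EuclideanSpace ℝ (Fin (n + 1))) 1 := by
  have hs : ∀ x ∈ K, -x ∈ K := by
    intro x hx
    rw [hsymm] at hx
    exact hx
  have hK : SCB K := by
    refine ⟨hconv, hcomp, ?_, hs⟩
    obtain ⟨x, hx⟩ := hint
    have hx' : -x ∈ interior K := by
      have : interior K = - interior K := by
        conv_lhs => rw [hsymm]
        exact (Homeomorph.neg _).preimage_interior K |>.symm
      rw [this]; simpa using hx
    have := hconv.interior hx hx' (by norm_num : (0:ℝ) ≤ 1/2) (by norm_num : (0:ℝ) ≤ 1/2) (by norm_num)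
    simpa using this
  obtain ⟨K₀, h₀⟩ := exists_max n
  obtain ⟨A, hA⟩ := mx_ellipsoid h₀
  have hv : volume K₀ * volume (polarBody K₀) =
      (volume (closedBall (0 : EuclideanSpace ℝ (Fin (n + 1))) 1)) ^ 2 := by
    rw [hA, prod_image, polar_ball, sq]
  have hM : IsMx K := ⟨hK, fun L hL => by rw [heq, ← hv]; exact h₀.2 L hL⟩
  obtain ⟨B, hB⟩ := mx_ellipsoid hM
  exact ⟨B.toLinearEquiv, hB⟩
end

end Part8

/-- Equality case of the Blaschke–Santaló inequality: if an origin-symmetric convex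
body `K` in `ℝ^{n+1}` satisfies `V(K)·V(K°) = V(B)²`, then `K` is an origin-centered
ellipsoid, i.e. the image of the closed unit ball under an invertible linear map. -/
theorem blaschke_santalo_equality {n : ℕ} (K : Set (EuclideanSpace ℝ (Fin (n + 1))))
    (hconv : Convex ℝ K) (hcomp : IsCompact K) (hint : (interior K).Nonempty)
    (hsymm : K = -K)
    (heq : volume K * volume (polarBody K) =
      (volume (closedBall (0 : EuclideanSpace ℝ (Fin (n + 1))) 1)) ^ 2) :
    ∃ A : EuclideanSpace ℝ (Fin (n + 1)) ≃ₗ[ℝ] EuclideanSpace ℝ (Fin (n + 1)),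
      K = A '' closedBall (0 : EuclideanSpace ℝ (Fin (n + 1))) 1 := by
  exact main_aux K hconv hcomp hint hsymm heq
end

section
/- Continuity of the Mahler volume in the Hausdorff distance: let K be an origin-symmetric convex body in ℝ^{n+1} containing the origin in its interior, and let (K_i) be a sequence of origin-symmetric convex bodies in ℝ^{n+1} converging to K in the Hausdorff distance. Then V(K_i)·V(K_i°) → V(K)·V(K°). -/
open MeasureTheory Metric Filter
open scoped RealInnerProductSpace Topology

open Pointwise in
theorem polar_smul_aux {n : ℕ} (K L : Set (EuclideanSpace ℝ (Fin (n + 1)))) (c : ℝ) (hc : 0 < c)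
    (h : K ⊆ c • L) : c⁻¹ • polarBody L ⊆ polarBody K := by
  rintro _ ⟨y, hy, rfl⟩ x hx
  obtain ⟨z, hz, rfl⟩ := h hx
  have := hy z hz
  simp only [inner_smul_left, inner_smul_right]
  simpa [hc.ne'] using this

open Pointwise in
theorem polar_smul_aux2 {n : ℕ} (K L : Set (EuclideanSpace ℝ (Fin (n + 1)))) (c : ℝ) (hc : 0 < c)
    (h : c • L ⊆ K) : polarBody K ⊆ c⁻¹ • polarBody L := by
  intro y hy
  refine ⟨c • y, ?_, ?_⟩
  · intro x hx
    have := hy (c • x) (h ⟨x, hx, rfl⟩)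
    simpa [inner_smul_left, inner_smul_right] using this
  · simp [smul_smul, hc.ne']

open Pointwise in
theorem sandwich_upper {E : Type*} [NormedAddCommGroup E] [NormedSpace ℝ E]
    (K L : Set E) (hconv : Convex ℝ K) (r ε : ℝ) (hε : 0 < ε)
    (hball : closedBall 0 r ⊆ K) (h : ∀ x ∈ L, ∃ y ∈ K, dist x y < ε * r) :
    L ⊆ (1 + ε) • K := by
  intro x hx
  obtain ⟨y, hy, hd⟩ := h x hx
  have hw : ε⁻¹ • (x - y) ∈ K := by
    apply hball
    rw [mem_closedBall_zero_iff, norm_smul, Real.norm_eq_abs, abs_of_pos (inv_pos.2 hε),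
      ← dist_eq_norm, inv_mul_le_iff₀ hε]
    exact hd.le
  rw [hconv.add_smul zero_le_one hε.le]
  refine ⟨y, ⟨y, hy, by simp⟩, x - y, ⟨_, hw, ?_⟩, by simp⟩
  simp [smul_smul, hε.ne']

open Pointwise in
theorem sandwich_lower {E : Type*} [NormedAddCommGroup E] [NormedSpace ℝ E]
    (K L : Set E) (hcomp : IsCompact K) (hL : Convex ℝ L) (hLc : IsClosed L)
    (r ε : ℝ) (hε : 0 < ε) (hε1 : ε < 1)
    (hball : closedBall 0 r ⊆ K) (h : ∀ x ∈ K, ∃ y ∈ L, dist x y < ε * r) :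
    (1 - ε) • K ⊆ L := by
  rintro _ ⟨x, hx, rfl⟩
  by_contra hn
  obtain ⟨f, u, hf, hu⟩ := geometric_hahn_banach_closed_point hL hLc hn
  obtain ⟨z, hz, hmax⟩ := hcomp.exists_isMaxOn ⟨x, hx⟩ f.continuous.continuousOn
  obtain ⟨y, hy, hd⟩ := h z hz
  have hw : ε⁻¹ • (z - y) ∈ K := by
    apply hball
    rw [mem_closedBall_zero_iff, norm_smul, Real.norm_eq_abs, abs_of_pos (inv_pos.2 hε),
      ← dist_eq_norm, inv_mul_le_iff₀ hε]
    exact hd.le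
  have h1 : f (ε⁻¹ • (z - y)) ≤ f z := hmax hw
  have h2 : f x ≤ f z := hmax hx
  have h3 := hf y hy
  simp only [map_smul, smul_eq_mul, map_sub] at h1 hu
  rw [inv_mul_le_iff₀ hε] at h1
  nlinarith

open Pointwise in
theorem mahler_aux {n : ℕ} (K : Set (EuclideanSpace ℝ (Fin (n + 1))))
    (hconv : Convex ℝ K) (hcomp : IsCompact K)
    (hint : (0 : EuclideanSpace ℝ (Fin (n + 1))) ∈ interior K)
    (Ki : ℕ → Set (EuclideanSpace ℝ (Fin (n + 1))))
    (hKiconv : ∀ i, Convex ℝ (Ki i)) (hKicomp : ∀ i, IsCompact (Ki i))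
    (hKiint : ∀ i, (interior (Ki i)).Nonempty)
    (hconverge : Tendsto (fun i => hausdorffDist (Ki i) K) atTop (𝓝 0)) :
    Tendsto (fun i => volume (Ki i) * volume (polarBody (Ki i))) atTop
      (𝓝 (volume K * volume (polarBody K))) := by
  obtain ⟨r, hr, hball⟩ := nhds_basis_closedBall.mem_iff.1 (mem_interior_iff_mem_nhds.1 hint)
  set d := Module.finrank ℝ (EuclideanSpace ℝ (Fin (n + 1))) with hd
  set ε : ℕ → ℝ := fun i => hausdorffDist (Ki i) K / r + 1 / ((i : ℝ) + 1) with hεd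
  have hε0 : Tendsto ε atTop (𝓝 0) := by
    simpa [hεd] using (hconverge.div_const r).add tendsto_one_div_add_atTop_nhds_zero_nat
  have hεpos : ∀ i, 0 < ε i := fun i => by
    have : 0 ≤ hausdorffDist (Ki i) K := hausdorffDist_nonneg
    simp only [hεd]
    positivity
  have hlt : ∀ i, hausdorffDist (Ki i) K < ε i * r := fun i => by
    have : ε i * r = hausdorffDist (Ki i) K + 1 / ((i : ℝ) + 1) * r := by
      simp only [hεd]
      field_simp
    rw [this]
    have : 0 < 1 / ((i : ℝ) + 1) * r := by positivity
    linarith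
  have hfin : ∀ i, hausdorffEDist (Ki i) K ≠ ⊤ := fun i =>
    hausdorffEDist_ne_top_of_nonempty_of_bounded ((hKiint i).mono interior_subset)
      ⟨0, interior_subset hint⟩ (hKicomp i).isBounded hcomp.isBounded
  have hup : ∀ i, Ki i ⊆ (1 + ε i) • K := fun i =>
    sandwich_upper K (Ki i) hconv r (ε i) (hεpos i) hball fun x hx =>
      exists_dist_lt_of_hausdorffDist_lt hx (hlt i) (hfin i)
  have hlow : ∀ i, ε i < 1 → (1 - ε i) • K ⊆ Ki i := fun i hi =>
    sandwich_lower K (Ki i) hcomp (hKiconv i) (hKicomp i).isClosed r (ε i) (hεpos i) hi hball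
      fun x hx => by
        obtain ⟨y, hy, h⟩ := exists_dist_lt_of_hausdorffDist_lt' hx (hlt i) (hfin i)
        exact ⟨y, hy, by rwa [dist_comm]⟩
  have hev : ∀ᶠ i in atTop, ε i < 1 := hε0.eventually_lt_const one_pos
  have hA : Tendsto (fun i => 1 + ε i) atTop (𝓝 1) := by simpa using hε0.const_add 1
  have hB : Tendsto (fun i => 1 - ε i) atTop (𝓝 1) := by simpa using hε0.const_sub 1
  have hvol : ∀ (c : ℝ) (S : Set (EuclideanSpace ℝ (Fin (n + 1)))), 0 < c →
      volume (c • S) = ENNReal.ofReal (c ^ d) * volume S := fun c S hc =>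
    Measure.addHaar_smul_of_nonneg volume hc.le S
  have key : ∀ (f g : ℕ → ℝ), Tendsto f atTop (𝓝 1) → Tendsto g atTop (𝓝 1) →
      Tendsto (fun i => ENNReal.ofReal (f i ^ d * (g i)⁻¹ ^ d) * (volume K * volume (polarBody K)))
        atTop (𝓝 (volume K * volume (polarBody K))) := by
    intro f g hf hg
    have h1 : Tendsto (fun i => f i ^ d * (g i)⁻¹ ^ d) atTop (𝓝 1) := by
      simpa using (hf.pow d).mul ((hg.inv₀ one_ne_zero).pow d)
    have h2 := ENNReal.tendsto_ofReal h1
    rw [ENNReal.ofReal_one] at h2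
    simpa using ENNReal.Tendsto.mul_const (b := volume K * volume (polarBody K)) h2
      (Or.inl one_ne_zero)
  have hre : ∀ a b : ℝ, 0 < a → 0 < b →
      ENNReal.ofReal (a ^ d * b⁻¹ ^ d) * (volume K * volume (polarBody K))
        = volume (a • K) * volume (b⁻¹ • polarBody K) := by
    intro a b ha hb
    rw [hvol a _ ha, hvol b⁻¹ _ (inv_pos.2 hb), ENNReal.ofReal_mul (by positivity)]
    ring
  refine tendsto_of_tendsto_of_tendsto_of_le_of_le' (key _ _ hB hA) (key _ _ hA hB) ?_ ?_
  · filter_upwards [hev] with i hi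
    have hp := hεpos i
    rw [hre _ _ (by linarith) (by linarith)]
    exact mul_le_mul' (measure_mono (hlow i hi))
      (measure_mono (polar_smul_aux _ _ _ (by linarith) (hup i)))
  · filter_upwards [hev] with i hi
    have hp := hεpos i
    rw [hre _ _ (by linarith) (by linarith)]
    exact mul_le_mul' (measure_mono (hup i))
      (measure_mono (polar_smul_aux2 _ _ _ (by linarith) (hlow i hi)))

/-- Continuity of the Mahler volume in the Hausdorff distance: if `K` is an
origin-symmetric convex body in `ℝ^{n+1}` with `0` in its interior and `(Kᵢ)` is a
sequence of origin-symmetric convex bodies converging to `K` in Hausdorff distance,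
then `V(Kᵢ)·V(Kᵢ°) → V(K)·V(K°)`. -/
theorem mahler_volume_continuous {n : ℕ} (K : Set (EuclideanSpace ℝ (Fin (n + 1))))
    (hconv : Convex ℝ K) (hcomp : IsCompact K)
    (hint : (0 : EuclideanSpace ℝ (Fin (n + 1))) ∈ interior K) (hsymm : K = -K)
    (Ki : ℕ → Set (EuclideanSpace ℝ (Fin (n + 1))))
    (hKiconv : ∀ i, Convex ℝ (Ki i)) (hKicomp : ∀ i, IsCompact (Ki i))
    (hKiint : ∀ i, (interior (Ki i)).Nonempty) (hKisymm : ∀ i, Ki i = -Ki i)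
    (hconverge : Tendsto (fun i => hausdorffDist (Ki i) K) atTop (𝓝 0)) :
    Tendsto (fun i => volume (Ki i) * volume (polarBody (Ki i))) atTop
      (𝓝 (volume K * volume (polarBody K))) := by
  exact mahler_aux K hconv hcomp hint Ki hKiconv hKicomp hKiint hconverge
end
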